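/- arXiv:2512.23414 — 15 statements merged into one kernel-verified Lean document; each statement's English description precedes it below -/
import Mathlib

section
/- Let W be a complex vector space, p : ℂ^d → W a real-linear map such that the 2d vectors p(e_1),…,p(e_d), p(i e_1),…,p(i e_d) are linearly independent over ℂ, K : W → W a complex-linear map, and A, B real-linear operators on ℂ^d such that K(p(z)) = p(A z) + i·p(B z) for every z ∈ ℂ^d. Let 𝐀, 𝐁 be the matrix identifications of A, B. If w ∈ ℂ^{2d}, λ ∈ ℂ and n ≥ 1 satisfy (𝐀 + i𝐁 − λ)^n w = 0 and (𝐀 + i𝐁 − λ)^{n−1} w ≠ 0, then the vector x := ∑_{j=1}^d ( w_j · p(e_j) + w_{d+j} · p(i e_j) ) satisfies (K − λ)^n x = 0 and (K − λ)^{n−1} x ≠ 0; in particular every eigenvalue of 𝐀 + i𝐁 is an eigenvalue of K. -/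
open Complex Matrix

/-- A real-linear map on `ℂ^d` is determined by its values at `e_j` and `i e_j`. -/
theorem realLinear_eq_sum {d : ℕ} {W : Type*} [AddCommGroup W] [Module ℂ W]
    {p : (Fin d → ℂ) → W} (hp_add : ∀ x y, p (x + y) = p x + p y)
    (hp_smul : ∀ (r : ℝ) x, p (r • x) = (r : ℂ) • p x) (z : Fin d → ℂ) :
    p z = ∑ j, (((z j).re : ℂ) • p (Pi.single j 1) +
      ((z j).im : ℂ) • p (Complex.I • Pi.single j 1)) := by
  have hz : z = ∑ j, ((z j).re • (Pi.single j 1 : Fin d → ℂ) +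
      (z j).im • (Complex.I • (Pi.single j 1 : Fin d → ℂ))) := by
    ext k
    simp [Finset.sum_apply, Finset.sum_add_distrib, Pi.single_apply]
  calc p z = AddMonoidHom.mk' p hp_add (∑ j, ((z j).re • (Pi.single j 1 : Fin d → ℂ) +
        (z j).im • (Complex.I • (Pi.single j 1 : Fin d → ℂ)))) := congrArg p hz
    _ = _ := by
      rw [map_sum]
      simp only [AddMonoidHom.mk'_apply, hp_add, hp_smul]

theorem Matrix.mulVec_iterate {ι R : Type*} [Fintype ι] [DecidableEq ι] [CommSemiring R]
    (N : Matrix ι ι R) (k : ℕ) (v : ι → R) : N.mulVec^[k] v = (N ^ k).mulVec v := by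
  induction k with
  | zero => simp
  | succ k ih => rw [Function.iterate_succ_apply', ih, Matrix.mulVec_mulVec, pow_succ']

/-- If a linear map acts on a finite family `b` through the matrix `M`, then it is
semiconjugate to `M`, and shifting by a scalar preserves this. -/
theorem semiconj_linearCombination_sub_smul {ι R W : Type*} [Fintype ι] [DecidableEq ι]
    [CommRing R] [AddCommGroup W] [Module R W] {b : ι → W} {f : W →ₗ[R] W} {M : Matrix ι ι R}
    (h : ∀ i, f (b i) = ∑ k, M k i • b k) (μ : R) :
    Function.Semiconj (Fintype.linearCombination R b) (M - μ • (1 : Matrix ι ι R)).mulVec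
      (fun y => f y - μ • y) := by
  have hM : Fintype.linearCombination R b ∘ₗ M.mulVecLin =
      f ∘ₗ Fintype.linearCombination R b := by
    ext i
    simp [Fintype.linearCombination_apply, h]
  intro v
  have hv := LinearMap.congr_fun hM v
  simp only [LinearMap.comp_apply, Matrix.mulVecLin_apply] at hv
  simp only [Matrix.sub_mulVec, Matrix.smul_mulVec, Matrix.one_mulVec, map_sub, map_smul, hv]

/-- Under the intertwining relation `K (p z) = p (A z) + i • p (B z)` and
linear independence of the vectors `p (e_j), p (i e_j)`, every generalized eigenvector of
order `n` of `𝐀 + i 𝐁` yields a generalized eigenvector of `K` of the same order `n`;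
in particular every eigenvalue of `𝐀 + i 𝐁` is an eigenvalue of `K`. -/
theorem stmt1 (d : ℕ) (W : Type*) [AddCommGroup W] [Module ℂ W]
    (p : (Fin d → ℂ) → W)
    (hp_add : ∀ x y, p (x + y) = p x + p y)
    (hp_smul : ∀ (r : ℝ) x, p (r • x) = (r : ℂ) • p x)
    (e : Fin d → Fin d → ℂ) (he : ∀ j, e j = Pi.single j 1)
    (hp_indep : LinearIndependent ℂ (fun jk : Fin d ⊕ Fin d => match jk with
      | Sum.inl j => p (e j)
      | Sum.inr j => p (Complex.I • e j)))
    (K : W → W)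
    (hK_add : ∀ x y, K (x + y) = K x + K y)
    (hK_smul : ∀ (c : ℂ) x, K (c • x) = c • K x)
    (A B : (Fin d → ℂ) → (Fin d → ℂ))
    (hA_add : ∀ x y, A (x + y) = A x + A y)
    (hA_smul : ∀ (r : ℝ) x, A (r • x) = r • A x)
    (hB_add : ∀ x y, B (x + y) = B x + B y)
    (hB_smul : ∀ (r : ℝ) x, B (r • x) = r • B x)
    (hKp : ∀ z, K (p z) = p (A z) + Complex.I • p (B z))
    (matA matB : Matrix (Fin d ⊕ Fin d) (Fin d ⊕ Fin d) ℂ)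
    (hmatA : ∀ j k, matA (Sum.inl k) (Sum.inl j) = ((A (e j)) k).re ∧
        matA (Sum.inr k) (Sum.inl j) = ((A (e j)) k).im ∧
        matA (Sum.inl k) (Sum.inr j) = ((A (Complex.I • e j)) k).re ∧
        matA (Sum.inr k) (Sum.inr j) = ((A (Complex.I • e j)) k).im)
    (hmatB : ∀ j k, matB (Sum.inl k) (Sum.inl j) = ((B (e j)) k).re ∧
        matB (Sum.inr k) (Sum.inl j) = ((B (e j)) k).im ∧
        matB (Sum.inl k) (Sum.inr j) = ((B (Complex.I • e j)) k).re ∧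
        matB (Sum.inr k) (Sum.inr j) = ((B (Complex.I • e j)) k).im)
    (w : (Fin d ⊕ Fin d) → ℂ) (lam : ℂ) (n : ℕ) (hn : 1 ≤ n)
    (hgen : (((matA + Complex.I • matB) - lam • (1 : Matrix (Fin d ⊕ Fin d) (Fin d ⊕ Fin d) ℂ)) ^ n).mulVec w = 0)
    (hgen' : (((matA + Complex.I • matB) - lam • (1 : Matrix (Fin d ⊕ Fin d) (Fin d ⊕ Fin d) ℂ)) ^ (n - 1)).mulVec w ≠ 0)
    (x : W)
    (hx : x = ∑ j : Fin d, (w (Sum.inl j) • p (e j) + w (Sum.inr j) • p (Complex.I • e j))) :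
    ((fun y => K y - lam • y)^[n] x = 0 ∧ (fun y => K y - lam • y)^[n - 1] x ≠ 0) ∧
    (∀ μ : ℂ, (∃ v : (Fin d ⊕ Fin d) → ℂ, v ≠ 0 ∧ (matA + Complex.I • matB).mulVec v = μ • v) →
      ∃ y : W, y ≠ 0 ∧ K y = μ • y) := by
  obtain rfl : e = fun j => Pi.single j 1 := funext he
  set b : Fin d ⊕ Fin d → W := fun jk => match jk with
    | Sum.inl j => p (Pi.single j 1)
    | Sum.inr j => p (Complex.I • Pi.single j 1) with hb
  have hb_indep : LinearIndependent ℂ b := hp_indep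
  have hinj : Function.Injective (Fintype.linearCombination ℂ b) :=
    hb_indep.fintypeLinearCombination_injective
  let f : W →ₗ[ℂ] W := { toFun := K, map_add' := hK_add, map_smul' := hK_smul }
  have hf : ∀ i, f (b i) = ∑ k, (matA + Complex.I • matB) k i • b k := by
    have hp := realLinear_eq_sum hp_add hp_smul
    have key : ∀ z, K (p z) = ∑ k, ((((A z k).re : ℂ) + Complex.I * ((B z k).re : ℂ)) •
        p (Pi.single k 1) + (((A z k).im : ℂ) + Complex.I * ((B z k).im : ℂ)) •
        p (Complex.I • Pi.single k 1)) := by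
      intro z
      rw [hKp, hp (A z), hp (B z), Finset.smul_sum, ← Finset.sum_add_distrib]
      refine Finset.sum_congr rfl fun k _ => ?_
      module
    rintro (j | j)
    · refine (key _).trans ?_
      simp [hb, Fintype.sum_sum_type, Finset.sum_add_distrib, (hmatA j _).1, (hmatA j _).2.1,
        (hmatB j _).1, (hmatB j _).2.1]
    · refine (key _).trans ?_
      simp [hb, Fintype.sum_sum_type, Finset.sum_add_distrib, (hmatA j _).2.2.1,
        (hmatA j _).2.2.2, (hmatB j _).2.2.1, (hmatB j _).2.2.2]
  have hxw : x = Fintype.linearCombination ℂ b w := by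
    rw [hx, Fintype.linearCombination_apply, Fintype.sum_sum_type, Finset.sum_add_distrib]
  have hiter : ∀ k, (fun y => K y - lam • y)^[k] x = Fintype.linearCombination ℂ b
      ((((matA + Complex.I • matB) - lam • (1 : Matrix _ _ ℂ)) ^ k).mulVec w) := by
    intro k
    rw [hxw, ← Matrix.mulVec_iterate]
    exact (((semiconj_linearCombination_sub_smul hf lam).iterate_right k) w).symm
  refine ⟨⟨by rw [hiter, hgen, map_zero], ?_⟩, ?_⟩
  · rw [hiter]
    exact (map_ne_zero_iff _ hinj).mpr hgen'
  · rintro μ ⟨v, hv, hMv⟩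
    refine ⟨Fintype.linearCombination ℂ b v, (map_ne_zero_iff _ hinj).mpr hv, ?_⟩
    have h := semiconj_linearCombination_sub_smul hf μ v
    rw [Matrix.sub_mulVec, Matrix.smul_mulVec, Matrix.one_mulVec, hMv, sub_self, map_zero] at h
    exact sub_eq_zero.mp h.symm
end

section
/- Let Z be a complex n×n matrix with every eigenvalue of strictly negative real part. Then for each complex n×n matrix C, the Lyapunov equation Z* S + S Z = −C has at most one solution S; equivalently, if Z* S + S Z = 0 then S = 0. -/
open Matrix

/-- If `S` intertwines `B` and `A`, then it intertwines `p(B)` and `p(A)` for every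
polynomial `p`. -/
theorem SemiconjBy.polynomial_aeval {R A : Type*} [CommSemiring R] [Semiring A] [Algebra R A]
    {s b a : A} (h : SemiconjBy s b a) (p : Polynomial R) :
    SemiconjBy s (Polynomial.aeval b p) (Polynomial.aeval a p) := by
  induction p using Polynomial.induction_on' with
  | add p q hp hq => simpa only [map_add] using hp.add_right hq
  | monomial k c =>
    simp only [Polynomial.aeval_monomial]
    exact SemiconjBy.mul_right (Algebra.commutes c s).symm (h.pow_right k)

/-- Matrices with disjoint spectra over an algebraically closed field have no nonzero
intertwiner. -/
theorem Matrix.eq_zero_of_semiconjBy_of_disjoint_spectrum {K m : Type*} [Field K]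
    [IsAlgClosed K] [Fintype m] [DecidableEq m] {S A B : Matrix m m K}
    (h : SemiconjBy S B A) (hAB : Disjoint (spectrum K A) (spectrum K B)) : S = 0 := by
  cases isEmpty_or_nonempty m
  · exact Subsingleton.elim _ _
  have hunit : IsUnit (Polynomial.aeval B A.charpoly) := by
    rw [← spectrum.zero_notMem_iff K, spectrum.map_polynomial_aeval_of_degree_pos]
    · rintro ⟨μ, hμB, hμ⟩
      exact Set.disjoint_left.mp hAB (mem_spectrum_iff_isRoot_charpoly.mpr hμ) hμB
    · rw [charpoly_degree_eq_dim]
      exact_mod_cast Fintype.card_pos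
  have key := (h.polynomial_aeval A.charpoly).eq
  rw [aeval_self_charpoly, zero_mul] at key
  exact hunit.mul_left_eq_zero.mp key

/-- The homogeneous Lyapunov equation of a stable matrix has only the zero solution. -/
theorem Matrix.eq_zero_of_lyapunov_eq_zero {m : Type*} [Fintype m] [DecidableEq m]
    {Z S : Matrix m m ℂ} (hZ : ∀ μ ∈ spectrum ℂ Z, μ.re < 0) (h : Zᴴ * S + S * Z = 0) :
    S = 0 := by
  refine eq_zero_of_semiconjBy_of_disjoint_spectrum (A := Zᴴ) (B := -Z) ?_ ?_
  · rw [SemiconjBy, mul_neg]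
    exact (eq_neg_of_add_eq_zero_left h).symm
  · rw [← star_eq_conjTranspose, spectrum.map_star, ← spectrum.neg_eq, Set.disjoint_left]
    intro μ hμ hμ'
    have h₁ := hZ _ (Set.mem_star.mp hμ)
    have h₂ := hZ _ (Set.mem_neg.mp hμ')
    rw [Complex.star_def, Complex.conj_re] at h₁
    rw [Complex.neg_re] at h₂
    linarith

/-- If every eigenvalue of `Z` has strictly negative real part, then for each
`C` the Lyapunov equation `Z* S + S Z = -C` has at most one solution; equivalently,
`Z* S + S Z = 0` implies `S = 0`. -/
theorem stmt3 (n : ℕ) (Z : Matrix (Fin n) (Fin n) ℂ)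
    (hZ : ∀ μ ∈ spectrum ℂ Z, μ.re < 0) :
    (∀ C S₁ S₂ : Matrix (Fin n) (Fin n) ℂ,
      Zᴴ * S₁ + S₁ * Z = -C → Zᴴ * S₂ + S₂ * Z = -C → S₁ = S₂) ∧
    (∀ S : Matrix (Fin n) (Fin n) ℂ, Zᴴ * S + S * Z = 0 → S = 0) := by
  refine ⟨fun C S₁ S₂ h₁ h₂ => sub_eq_zero.mp (eq_zero_of_lyapunov_eq_zero hZ ?_),
    fun S => eq_zero_of_lyapunov_eq_zero hZ⟩
  rw [mul_sub, sub_mul, sub_add_sub_comm, h₁, h₂, sub_self]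
end

section
/- Let β_1,…,β_d > 0, let U, V be complex m×d matrices, and let Ω be a Hermitian d×d complex matrix. Suppose that { (UᵀŪ − VᵀV̄)/2 , D_coth } + i [ D_coth , Ω ] = −( UᵀŪ + VᵀV̄ ), where {·,·} is the anticommutator and [·,·] the commutator. Then for all 1 ≤ j,k ≤ d, the (j,k)-entry of { (UᵀŪ − VᵀV̄)/2 , D_csch } + i [ D_csch , Ω ] equals −2 (UᵀŪ)_{jk} / ( e^{−β_j/2} + e^{−β_k/2} ) − 2 (VᵀV̄)_{jk} / ( e^{β_j/2} + e^{β_k/2} ). -/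
open Matrix Complex

theorem ofReal_sinh_eq_exp (t : ℝ) :
    (Real.sinh t : ℂ) =
      ((Real.exp t : ℂ) ^ 2 - 1) / (2 * (Real.exp t : ℂ)) := by
  have h : Real.exp t ≠ 0 := (Real.exp_pos t).ne'
  have key : Real.sinh t = (Real.exp t ^ 2 - 1) / (2 * Real.exp t) := by
    rw [Real.sinh_eq, Real.exp_neg]
    field_simp
  rw [key]
  push_cast
  rfl

theorem ofReal_cosh_eq_exp (t : ℝ) :
    (Real.cosh t : ℂ) =
      ((Real.exp t : ℂ) ^ 2 + 1) / (2 * (Real.exp t : ℂ)) := by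
  have h : Real.exp t ≠ 0 := (Real.exp_pos t).ne'
  have key : Real.cosh t = (Real.exp t ^ 2 + 1) / (2 * Real.exp t) := by
    rw [Real.cosh_eq, Real.exp_neg]
    field_simp
  rw [key]
  push_cast
  rfl

/-- Entrywise formula for `{ (UᵀŪ − VᵀV̄)/2 , D_csch } + i [ D_csch , Ω ]`
given the corresponding identity with `D_coth`. -/
theorem stmt4 (d m : ℕ) (β : Fin d → ℝ) (hβ : ∀ j, 0 < β j)
    (U V : Matrix (Fin m) (Fin d) ℂ)
    (Ω : Matrix (Fin d) (Fin d) ℂ) (hΩ : Ω.IsHermitian)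
    (Dcoth Dcsch : Matrix (Fin d) (Fin d) ℂ)
    (hcoth : Dcoth = Matrix.diagonal fun j => ((Real.cosh (β j / 2) / Real.sinh (β j / 2)) : ℂ))
    (hcsch : Dcsch = Matrix.diagonal fun j => ((Real.sinh (β j / 2))⁻¹ : ℂ))
    (hLyap : ((1 : ℂ) / 2) •
        ((Uᵀ * U.map (starRingEnd ℂ) - Vᵀ * V.map (starRingEnd ℂ)) * Dcoth +
          Dcoth * (Uᵀ * U.map (starRingEnd ℂ) - Vᵀ * V.map (starRingEnd ℂ))) +
        Complex.I • (Dcoth * Ω - Ω * Dcoth) =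
        -(Uᵀ * U.map (starRingEnd ℂ) + Vᵀ * V.map (starRingEnd ℂ))) :
    ∀ j k : Fin d,
      (((1 : ℂ) / 2) •
        ((Uᵀ * U.map (starRingEnd ℂ) - Vᵀ * V.map (starRingEnd ℂ)) * Dcsch +
          Dcsch * (Uᵀ * U.map (starRingEnd ℂ) - Vᵀ * V.map (starRingEnd ℂ))) +
        Complex.I • (Dcsch * Ω - Ω * Dcsch)) j k =
      -2 * (Uᵀ * U.map (starRingEnd ℂ)) j k /
          ((Real.exp (-β j / 2) : ℂ) + (Real.exp (-β k / 2) : ℂ)) -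
        2 * (Vᵀ * V.map (starRingEnd ℂ)) j k /
          ((Real.exp (β j / 2) : ℂ) + (Real.exp (β k / 2) : ℂ)) := by
  intro j k
  have h := congrFun (congrFun hLyap j) k
  subst hcoth hcsch
  generalize Uᵀ * U.map (starRingEnd ℂ) = P at h ⊢
  generalize Vᵀ * V.map (starRingEnd ℂ) = Q at h ⊢
  simp only [Matrix.add_apply, Matrix.sub_apply, Matrix.neg_apply, Matrix.smul_apply,
    Matrix.mul_diagonal, Matrix.diagonal_mul, smul_eq_mul] at h ⊢
  simp only [ofReal_sinh_eq_exp, ofReal_cosh_eq_exp] at h ⊢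
  simp only [neg_div, Real.exp_neg, Complex.ofReal_inv]
  have one_lt (i : Fin d) : 1 < Real.exp (β i / 2) := Real.one_lt_exp_iff.2 (half_pos (hβ i))
  have ne_zero (i : Fin d) : (Real.exp (β i / 2) : ℂ) ≠ 0 :=
    Complex.ofReal_ne_zero.2 (Real.exp_pos _).ne'
  have sq_ne (i : Fin d) : (Real.exp (β i / 2) : ℂ) ^ 2 - 1 ≠ 0 := by
    have : Real.exp (β i / 2) ^ 2 - 1 ≠ 0 := by nlinarith [one_lt i]
    exact_mod_cast this
  have add_ne : (Real.exp (β j / 2) : ℂ) + (Real.exp (β k / 2) : ℂ) ≠ 0 := by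
    have : Real.exp (β j / 2) + Real.exp (β k / 2) ≠ 0 := by positivity
    exact_mod_cast this
  have hx := ne_zero j
  have hy := ne_zero k
  have hx2 := sq_ne j
  have hy2 := sq_ne k
  generalize (Real.exp (β j / 2) : ℂ) = x at *
  generalize (Real.exp (β k / 2) : ℂ) = y at *
  have inv_add : x⁻¹ + y⁻¹ = (x + y) / (x * y) := by
    field_simp
    ring
  rw [inv_add]
  linear_combination (norm := skip) (1 + x * y) / (x + y) * h
  field_simp
  ring
end

section
/- Let β_1,…,β_d > 0, let U, V be complex m×d matrices, and let κ be a symmetric d×d complex matrix. Suppose that [ (VᵀU − UᵀV)/2 , D_coth ] + i { κ , D_coth } = −( UᵀV + VᵀU ), where {·,·} is the anticommutator and [·,·] the commutator. Then for all 1 ≤ j,k ≤ d, the (j,k)-entry of [ (VᵀU − UᵀV)/2 , D_csch ] + i { κ , D_csch } equals −2 (UᵀV)_{jk} / ( e^{−β_j/2} + e^{β_k/2} ) − 2 (VᵀU)_{jk} / ( e^{β_j/2} + e^{−β_k/2} ). -/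
open Matrix Complex

/-- If `p = e^x` and `q = e^y`, then `coth x = (p² + 1) / (p² - 1)` and `csch x = 2p / (p² - 1)`;
this is the scalar identity obtained by eliminating `w` between the two relations. -/
lemma csch_combination_of_coth_combination {K : Type*} [Field K] {p q a b w : K}
    (h2 : (2 : K) ≠ 0) (hp : p ^ 2 - 1 ≠ 0) (hq : q ^ 2 - 1 ≠ 0) (hpq : p * q + 1 ≠ 0)
    (h : 1 / 2 * ((b - a) * ((q ^ 2 + 1) / (q ^ 2 - 1)) - (p ^ 2 + 1) / (p ^ 2 - 1) * (b - a)) +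
      w * ((p ^ 2 + 1) / (p ^ 2 - 1) + (q ^ 2 + 1) / (q ^ 2 - 1)) = -(a + b)) :
    1 / 2 * ((b - a) * (2 * q / (q ^ 2 - 1)) - 2 * p / (p ^ 2 - 1) * (b - a)) +
      w * (2 * p / (p ^ 2 - 1) + 2 * q / (q ^ 2 - 1)) =
      -(2 * a * p / (p * q + 1)) - 2 * b * q / (p * q + 1) := by
  have key : (b - a) * (p ^ 2 - q ^ 2) + 2 * w * (p * q + 1) * (p * q - 1) +
      (a + b) * (p ^ 2 - 1) * (q ^ 2 - 1) = 0 := by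
    field_simp at h
    apply mul_left_cancel₀ h2
    linear_combination h
  have hqp : q * p + 1 ≠ 0 := by rwa [mul_comm]
  field_simp
  linear_combination (p + q) * key

lemma cosh_div_sinh_eq_exp {x : ℝ} (hx : 0 < x) :
    Real.cosh x / Real.sinh x = (Real.exp x ^ 2 + 1) / (Real.exp x ^ 2 - 1) := by
  have h1 : 1 < Real.exp x := Real.one_lt_exp_iff.mpr hx
  have h2 : Real.exp x ^ 2 - 1 ≠ 0 := (sub_pos.mpr (one_lt_pow₀ h1 two_ne_zero)).ne'
  rw [Real.cosh_eq, Real.sinh_eq, Real.exp_neg]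
  have h3 : Real.exp x ≠ 0 := by positivity
  field_simp

lemma inv_sinh_eq_exp {x : ℝ} (hx : 0 < x) :
    (Real.sinh x)⁻¹ = 2 * Real.exp x / (Real.exp x ^ 2 - 1) := by
  have h1 : 1 < Real.exp x := Real.one_lt_exp_iff.mpr hx
  have h2 : Real.exp x ^ 2 - 1 ≠ 0 := (sub_pos.mpr (one_lt_pow₀ h1 two_ne_zero)).ne'
  rw [Real.sinh_eq, Real.exp_neg]
  have h3 : Real.exp x ≠ 0 := by positivity
  field_simp

/-- Entrywise formula for `[ (VᵀU − UᵀV)/2 , D_csch ] + i { κ , D_csch }`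
given the corresponding identity with `D_coth`. -/
theorem stmt5 (d m : ℕ) (β : Fin d → ℝ) (hβ : ∀ j, 0 < β j)
    (U V : Matrix (Fin m) (Fin d) ℂ)
    (κ : Matrix (Fin d) (Fin d) ℂ) (hκ : κᵀ = κ)
    (Dcoth Dcsch : Matrix (Fin d) (Fin d) ℂ)
    (hcoth : Dcoth = Matrix.diagonal fun j => ((Real.cosh (β j / 2) / Real.sinh (β j / 2)) : ℂ))
    (hcsch : Dcsch = Matrix.diagonal fun j => ((Real.sinh (β j / 2))⁻¹ : ℂ))
    (hLyap : ((1 : ℂ) / 2) •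
        ((Vᵀ * U - Uᵀ * V) * Dcoth - Dcoth * (Vᵀ * U - Uᵀ * V)) +
        Complex.I • (κ * Dcoth + Dcoth * κ) =
        -(Uᵀ * V + Vᵀ * U)) :
    ∀ j k : Fin d,
      (((1 : ℂ) / 2) •
        ((Vᵀ * U - Uᵀ * V) * Dcsch - Dcsch * (Vᵀ * U - Uᵀ * V)) +
        Complex.I • (κ * Dcsch + Dcsch * κ)) j k =
      -2 * (Uᵀ * V) j k /
          ((Real.exp (-β j / 2) : ℂ) + (Real.exp (β k / 2) : ℂ)) -
        2 * (Vᵀ * U) j k /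
          ((Real.exp (β j / 2) : ℂ) + (Real.exp (-β k / 2) : ℂ)) := by
  intro j k
  have hj : 0 < β j / 2 := half_pos (hβ j)
  have hk : 0 < β k / 2 := half_pos (hβ k)
  have h := congrFun (congrFun hLyap j) k
  subst hcoth hcsch
  simp only [← Complex.ofReal_div, ← Complex.ofReal_inv] at h ⊢
  simp only [Matrix.add_apply, Matrix.sub_apply, Matrix.smul_apply, Matrix.neg_apply,
    Matrix.mul_diagonal, Matrix.diagonal_mul, smul_eq_mul] at h ⊢
  rw [cosh_div_sinh_eq_exp hj, cosh_div_sinh_eq_exp hk] at h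
  rw [inv_sinh_eq_exp hj, inv_sinh_eq_exp hk, neg_div, neg_div, Real.exp_neg, Real.exp_neg]
  have hp : 1 < Real.exp (β j / 2) := Real.one_lt_exp_iff.mpr hj
  have hq : 1 < Real.exp (β k / 2) := Real.one_lt_exp_iff.mpr hk
  generalize Real.exp (β j / 2) = p at *
  generalize Real.exp (β k / 2) = q at *
  generalize (Uᵀ * V) j k = a at *
  generalize (Vᵀ * U) j k = b at *
  have hp0 : (p : ℂ) ≠ 0 := by exact_mod_cast (zero_lt_one.trans hp).ne'
  have hq0 : (q : ℂ) ≠ 0 := by exact_mod_cast (zero_lt_one.trans hq).ne'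
  have hp1 : (p : ℂ) ^ 2 - 1 ≠ 0 := by exact_mod_cast (by nlinarith : 0 < p ^ 2 - 1).ne'
  have hq1 : (q : ℂ) ^ 2 - 1 ≠ 0 := by exact_mod_cast (by nlinarith : 0 < q ^ 2 - 1).ne'
  have hpq : (p : ℂ) * q + 1 ≠ 0 := by exact_mod_cast (by nlinarith : 0 < p * q + 1).ne'
  push_cast at h ⊢
  have hU : -2 * a / ((p : ℂ)⁻¹ + q) = -(2 * a * p / (p * q + 1)) := by
    rw [show (p : ℂ)⁻¹ + q = (p * q + 1) / p by field_simp; ring]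
    field_simp
  have hV : 2 * b / ((p : ℂ) + (q : ℂ)⁻¹) = 2 * b * q / (p * q + 1) := by
    rw [show (p : ℂ) + (q : ℂ)⁻¹ = (p * q + 1) / q by field_simp]
    field_simp
  rw [hU, hV, ← csch_combination_of_coth_combination (w := Complex.I * κ j k)
    two_ne_zero hp1 hq1 hpq (by linear_combination h)]
  ring
end

section
/- Let β_1,…,β_d > 0, let U = [u_{jk}], V = [v_{jk}] be complex m×d matrices, let Ω be Hermitian and κ symmetric d×d complex matrices, and suppose the two identities { (UᵀŪ − VᵀV̄)/2 , D_coth } + i [ D_coth , Ω ] = −( UᵀŪ + VᵀV̄ ) and [ (VᵀU − UᵀV)/2 , D_coth ] + i { κ , D_coth } = −( UᵀV + VᵀU ) hold. Then: (i) for all j ≠ k with β_j ≠ β_k, i Ω_{jk} = ( 2 e^{β_k} − 1 − e^{β_k − β_j} ) / ( 2 (1 − e^{β_k − β_j}) ) · (UᵀŪ)_{jk} + ( 2 e^{−β_j} − 1 − e^{β_k − β_j} ) / ( 2 (1 − e^{β_k − β_j}) ) · (VᵀV̄)_{jk}; and (ii) for all j, k, i κ_{jk} = ( 2 e^{β_j}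 − e^{β_j + β_k} − 1 ) / ( 2 ( e^{β_j + β_k} − 1 ) ) · (UᵀV)_{jk} + ( 2 e^{β_k} − e^{β_j + β_k} − 1 ) / ( 2 ( e^{β_j + β_k} − 1 ) ) · (VᵀU)_{jk}. -/
open Matrix Complex

/-- The hyperbolic cotangent of `b / 2` in terms of `exp b`. -/
lemma ofReal_cosh_div_sinh_half {b : ℝ} (hb : 0 < b) :
    ((Real.cosh (b / 2) : ℂ) / (Real.sinh (b / 2) : ℂ)) =
      ((Real.exp b : ℂ) + 1) / ((Real.exp b : ℂ) - 1) := by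
  have key : Real.cosh (b / 2) / Real.sinh (b / 2) = (Real.exp b + 1) / (Real.exp b - 1) := by
    have h1 : Real.exp b - 1 ≠ 0 := (sub_pos.2 (Real.one_lt_exp_iff.2 hb)).ne'
    have h2 : Real.sinh (b / 2) ≠ 0 := (Real.sinh_pos_iff.2 (half_pos hb)).ne'
    have h3 : Real.exp b = Real.exp (b / 2) * Real.exp (b / 2) := by
      rw [← Real.exp_add, add_halves]
    have h4 : Real.exp (b / 2) * Real.exp (-(b / 2)) = 1 := by
      rw [← Real.exp_add, add_neg_cancel, Real.exp_zero]
    rw [div_eq_div_iff h2 h1, h3, Real.cosh_eq, Real.sinh_eq]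
    linear_combination Real.exp (b / 2) * h4
  exact_mod_cast key

/-- Solving the scalar equation for an off-diagonal entry of the commutator identity. -/
lemma lyapunov_commutator_solve {x y A B w : ℂ} (hx : x ≠ 0) (hx1 : x - 1 ≠ 0) (hy1 : y - 1 ≠ 0)
    (hxy : x - y ≠ 0)
    (h : 1 / 2 * (A - B) * ((x + 1) / (x - 1) + (y + 1) / (y - 1)) +
      w * ((x + 1) / (x - 1) - (y + 1) / (y - 1)) = -(A + B)) :
    w = (2 * y - 1 - y / x) / (2 * (1 - y / x)) * A +
      (2 * x⁻¹ - 1 - y / x) / (2 * (1 - y / x)) * B := by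
  have e1 : (2 * y - 1 - y / x) / (2 * (1 - y / x)) = (2 * x * y - x - y) / (2 * (x - y)) := by
    have : 1 - y / x ≠ 0 := by rw [one_sub_div hx]; exact div_ne_zero hxy hx
    field_simp
  have e2 : (2 * x⁻¹ - 1 - y / x) / (2 * (1 - y / x)) = (2 - x - y) / (2 * (x - y)) := by
    have : 1 - y / x ≠ 0 := by rw [one_sub_div hx]; exact div_ne_zero hxy hx
    field_simp
  rw [e1, e2]
  field_simp at h ⊢
  linear_combination (-1 / 2) * h

/-- Solving the scalar equation for an entry of the anticommutator identity. -/
lemma lyapunov_anticommutator_solve {x y P Q w : ℂ} (hx1 : x - 1 ≠ 0) (hy1 : y - 1 ≠ 0)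
    (hxy : x * y - 1 ≠ 0)
    (h : 1 / 2 * (Q - P) * ((y + 1) / (y - 1) - (x + 1) / (x - 1)) +
      w * ((y + 1) / (y - 1) + (x + 1) / (x - 1)) = -(P + Q)) :
    w = (2 * x - x * y - 1) / (2 * (x * y - 1)) * P +
      (2 * y - x * y - 1) / (2 * (x * y - 1)) * Q := by
  field_simp at h
  rw [div_mul_eq_mul_div, div_mul_eq_mul_div, ← add_div,
    eq_div_iff (mul_ne_zero two_ne_zero hxy)]
  linear_combination (1 / 2) * h

/-- Formulas for `i Ω_{jk}` (for `j ≠ k` with `β_j ≠ β_k`) and `i κ_{jk}`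
determined by the two Lyapunov-type identities with `D_coth`. -/
theorem stmt6 (d m : ℕ) (β : Fin d → ℝ) (hβ : ∀ j, 0 < β j)
    (U V : Matrix (Fin m) (Fin d) ℂ)
    (Ω : Matrix (Fin d) (Fin d) ℂ) (hΩ : Ω.IsHermitian)
    (κ : Matrix (Fin d) (Fin d) ℂ) (hκ : κᵀ = κ)
    (Dcoth : Matrix (Fin d) (Fin d) ℂ)
    (hcoth : Dcoth = Matrix.diagonal fun j => ((Real.cosh (β j / 2) / Real.sinh (β j / 2)) : ℂ))
    (hLyap1 : ((1 : ℂ) / 2) •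
        ((Uᵀ * U.map (starRingEnd ℂ) - Vᵀ * V.map (starRingEnd ℂ)) * Dcoth +
          Dcoth * (Uᵀ * U.map (starRingEnd ℂ) - Vᵀ * V.map (starRingEnd ℂ))) +
        Complex.I • (Dcoth * Ω - Ω * Dcoth) =
        -(Uᵀ * U.map (starRingEnd ℂ) + Vᵀ * V.map (starRingEnd ℂ)))
    (hLyap2 : ((1 : ℂ) / 2) •
        ((Vᵀ * U - Uᵀ * V) * Dcoth - Dcoth * (Vᵀ * U - Uᵀ * V)) +
        Complex.I • (κ * Dcoth + Dcoth * κ) =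
        -(Uᵀ * V + Vᵀ * U)) :
    (∀ j k : Fin d, j ≠ k → β j ≠ β k →
      Complex.I * Ω j k =
        ((2 * Real.exp (β k) - 1 - Real.exp (β k - β j) : ℝ) : ℂ) /
            (2 * ((1 - Real.exp (β k - β j) : ℝ) : ℂ)) * (Uᵀ * U.map (starRingEnd ℂ)) j k +
          ((2 * Real.exp (-β j) - 1 - Real.exp (β k - β j) : ℝ) : ℂ) /
            (2 * ((1 - Real.exp (β k - β j) : ℝ) : ℂ)) * (Vᵀ * V.map (starRingEnd ℂ)) j k) ∧
    (∀ j k : Fin d,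
      Complex.I * κ j k =
        ((2 * Real.exp (β j) - Real.exp (β j + β k) - 1 : ℝ) : ℂ) /
            (2 * ((Real.exp (β j + β k) - 1 : ℝ) : ℂ)) * (Uᵀ * V) j k +
          ((2 * Real.exp (β k) - Real.exp (β j + β k) - 1 : ℝ) : ℂ) /
            (2 * ((Real.exp (β j + β k) - 1 : ℝ) : ℂ)) * (Vᵀ * U) j k) := by
  have exp_sub_one_ne (j : Fin d) : (Real.exp (β j) : ℂ) - 1 ≠ 0 := by
    exact_mod_cast (sub_pos.2 (Real.one_lt_exp_iff.2 (hβ j))).ne'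
  have exp_ne (j : Fin d) : (Real.exp (β j) : ℂ) ≠ 0 := by
    exact_mod_cast (Real.exp_pos (β j)).ne'
  subst hcoth
  refine ⟨fun j k _ hne => ?_, fun j k => ?_⟩
  · have h := congrFun (congrFun hLyap1 j) k
    simp only [Matrix.add_apply, Matrix.sub_apply, Matrix.neg_apply, Matrix.smul_apply,
      Matrix.mul_diagonal, Matrix.diagonal_mul, smul_eq_mul,
      ofReal_cosh_div_sinh_half (hβ _)] at h
    have hxy : (Real.exp (β j) : ℂ) - Real.exp (β k) ≠ 0 := by
      exact_mod_cast sub_ne_zero.2 (Real.exp_injective.ne hne)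
    rw [Real.exp_sub, Real.exp_neg]
    simp only [Complex.ofReal_sub, Complex.ofReal_mul, Complex.ofReal_div, Complex.ofReal_inv,
      Complex.ofReal_one, Complex.ofReal_ofNat]
    exact lyapunov_commutator_solve (exp_ne j) (exp_sub_one_ne j) (exp_sub_one_ne k) hxy
      (by linear_combination h)
  · have h := congrFun (congrFun hLyap2 j) k
    simp only [Matrix.add_apply, Matrix.sub_apply, Matrix.neg_apply, Matrix.smul_apply,
      Matrix.mul_diagonal, Matrix.diagonal_mul, smul_eq_mul,
      ofReal_cosh_div_sinh_half (hβ _)] at h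
    have hxy : (Real.exp (β j) : ℂ) * Real.exp (β k) - 1 ≠ 0 := by
      rw [← Complex.ofReal_mul, ← Real.exp_add]
      exact_mod_cast (sub_pos.2 (Real.one_lt_exp_iff.2 (add_pos (hβ j) (hβ k)))).ne'
    rw [Real.exp_add]
    simp only [Complex.ofReal_sub, Complex.ofReal_mul, Complex.ofReal_one, Complex.ofReal_ofNat]
    exact lyapunov_anticommutator_solve (exp_sub_one_ne j) (exp_sub_one_ne k) hxy
      (by linear_combination h)
end

section
/- Let β_1,…,β_d > 0 and let U = [u_{jk}], V = [v_{jk}] be complex m×d matrices. Define the real-linear operator T on ℂ^d by T z = M z + N z̄, where M_{jk} = −2 (UᵀŪ)_{jk} / ( e^{−β_j/2} + e^{−β_k/2} ) − 2 (VᵀV̄)_{jk} / ( e^{β_j/2} + e^{β_k/2} ) and N_{jk} = −2 (UᵀV)_{jk} / ( e^{−β_j/2} + e^{β_k/2} ) − 2 (VᵀU)_{jk} / ( e^{β_j/2} + e^{−β_k/2} ). For t ≥ 0 define the real-linear map A_t : ℂ^d → ℂ^m by A_t z = P_t z + Q_t z̄, where (P_t)_{jk} = exp(−t e^{−β_k/2})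 · conj(u_{jk}) and (Q_t)_{jk} = exp(−t e^{β_k/2}) · v_{jk}. Then for every w ∈ ℂ^d, Re⟨w, T w⟩ = −2 ∫₀^∞ ‖A_t w‖² dt; in particular Re⟨w, T w⟩ ≤ 0, with equality if and only if A_t w = 0 for all t ≥ 0. -/
open Matrix Complex MeasureTheory

/-- The squared norm of a finite sum of decaying exponentials, expanded. -/
lemma norm_sq_sum_exp_mul {σ : Type*} [Fintype σ] (r : σ → ℝ) (c : σ → ℂ) (t : ℝ) :
    ‖∑ s, (Real.exp (-(t * r s)) : ℂ) * c s‖ ^ 2 =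
      ∑ s, ∑ s', ((starRingEnd ℂ) (c s) * c s').re * Real.exp (-(r s + r s') * t) := by
  have h : (((‖∑ s, (Real.exp (-(t * r s)) : ℂ) * c s‖ ^ 2 : ℝ)) : ℂ) =
      ∑ s, ∑ s', ((starRingEnd ℂ) (c s) * c s') * (Real.exp (-(r s + r s') * t) : ℂ) := by
    rw [Complex.ofReal_pow, ← Complex.conj_mul', map_sum, Finset.sum_mul_sum]
    refine Finset.sum_congr rfl fun s _ => Finset.sum_congr rfl fun s' _ => ?_
    rw [map_mul, Complex.conj_ofReal,
      show -(r s + r s') * t = -(t * r s) + -(t * r s') by ring, Real.exp_add, Complex.ofReal_mul]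
    ring
  rw [← Complex.ofReal_re (‖_‖ ^ 2), h, Complex.re_sum]
  refine Finset.sum_congr rfl fun s _ => ?_
  rw [Complex.re_sum]
  exact Finset.sum_congr rfl fun s' _ => Complex.re_mul_ofReal _ _

lemma integrableOn_norm_sq_sum_exp_mul {σ : Type*} [Fintype σ] (r : σ → ℝ) (hr : ∀ s, 0 < r s)
    (c : σ → ℂ) :
    IntegrableOn (fun t : ℝ => ‖∑ s, (Real.exp (-(t * r s)) : ℂ) * c s‖ ^ 2) (Set.Ici 0) := by
  rw [integrableOn_Ici_iff_integrableOn_Ioi]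
  simp_rw [norm_sq_sum_exp_mul]
  exact integrable_finsetSum _ fun s _ => integrable_finsetSum _ fun s' _ =>
    (exp_neg_integrableOn_Ioi 0 (add_pos (hr s) (hr s'))).const_mul _

lemma integral_norm_sq_sum_exp_mul {σ : Type*} [Fintype σ] (r : σ → ℝ) (hr : ∀ s, 0 < r s)
    (c : σ → ℂ) :
    ∫ t in Set.Ici (0 : ℝ), ‖∑ s, (Real.exp (-(t * r s)) : ℂ) * c s‖ ^ 2 =
      ∑ s, ∑ s', ((starRingEnd ℂ) (c s) * c s').re / (r s + r s') := by
  have hint (s s' : σ) : IntegrableOn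
      (fun t => ((starRingEnd ℂ) (c s) * c s').re * Real.exp (-(r s + r s') * t)) (Set.Ioi 0) :=
    (exp_neg_integrableOn_Ioi 0 (add_pos (hr s) (hr s'))).const_mul _
  rw [integral_Ici_eq_integral_Ioi]
  simp_rw [norm_sq_sum_exp_mul]
  rw [integral_finsetSum _ fun s _ => integrable_finsetSum _ fun s' _ => hint s s']
  refine Finset.sum_congr rfl fun s _ => ?_
  rw [integral_finsetSum _ fun s' _ => hint s s']
  refine Finset.sum_congr rfl fun s' _ => ?_
  rw [integral_const_mul, integral_exp_mul_Ioi (neg_lt_zero.2 (add_pos (hr s) (hr s')))]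
  simp [div_eq_mul_inv, neg_inv]

/-- A continuous nonnegative function integrable on the half-line has zero integral there iff it
vanishes there. -/
lemma setIntegral_Ici_eq_zero_iff {f : ℝ → ℝ} (hf : Continuous f) (h0 : ∀ t, 0 ≤ f t) (a : ℝ)
    (hi : IntegrableOn f (Set.Ici a)) :
    ∫ t in Set.Ici a, f t = 0 ↔ ∀ t ≥ a, f t = 0 := by
  constructor
  · intro h
    rw [setIntegral_eq_zero_iff_of_nonneg_ae (Filter.Eventually.of_forall h0) hi] at h
    have := Measure.eqOn_of_ae_eq h hf.continuousOn continuousOn_const (by simp)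
    exact fun t ht => this ht
  · exact fun h => setIntegral_eq_zero_of_forall_eq_zero h

/-- The quadratic form of the real-linear operator
`T = Z^♯ D_csch + D_csch Z` equals `−2 ∫₀^∞ ‖A_t w‖² dt`; in particular it is
nonpositive, vanishing iff `A_t w = 0` for all `t ≥ 0`. -/
theorem stmt7 (d m : ℕ) (β : Fin d → ℝ) (hβ : ∀ j, 0 < β j)
    (U V : Matrix (Fin m) (Fin d) ℂ)
    (M N : Matrix (Fin d) (Fin d) ℂ)
    (hM : ∀ j k, M j k =
      -2 * (Uᵀ * U.map (starRingEnd ℂ)) j k /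
          ((Real.exp (-β j / 2) : ℂ) + (Real.exp (-β k / 2) : ℂ)) -
        2 * (Vᵀ * V.map (starRingEnd ℂ)) j k /
          ((Real.exp (β j / 2) : ℂ) + (Real.exp (β k / 2) : ℂ)))
    (hN : ∀ j k, N j k =
      -2 * (Uᵀ * V) j k /
          ((Real.exp (-β j / 2) : ℂ) + (Real.exp (β k / 2) : ℂ)) -
        2 * (Vᵀ * U) j k /
          ((Real.exp (β j / 2) : ℂ) + (Real.exp (-β k / 2) : ℂ)))
    (T : (Fin d → ℂ) → (Fin d → ℂ))
    (hT : ∀ z, T z = M.mulVec z + N.mulVec (star z))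
    (P Q : ℝ → Matrix (Fin m) (Fin d) ℂ)
    (hP : ∀ t j k, P t j k = (Real.exp (-(t * Real.exp (-β k / 2))) : ℂ) * (starRingEnd ℂ) (U j k))
    (hQ : ∀ t j k, Q t j k = (Real.exp (-(t * Real.exp (β k / 2))) : ℂ) * V j k)
    (A : ℝ → (Fin d → ℂ) → (Fin m → ℂ))
    (hA : ∀ t z, A t z = (P t).mulVec z + (Q t).mulVec (star z)) :
    ∀ w : Fin d → ℂ,
      (∑ k, (starRingEnd ℂ) (w k) * T w k).re =
        -2 * ∫ t in Set.Ici (0 : ℝ), ∑ j, ‖A t w j‖ ^ 2 ∧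
      (∑ k, (starRingEnd ℂ) (w k) * T w k).re ≤ 0 ∧
      ((∑ k, (starRingEnd ℂ) (w k) * T w k).re = 0 ↔ ∀ t ≥ (0 : ℝ), A t w = 0) := by
  intro w
  set r : Fin d ⊕ Fin d → ℝ :=
    Sum.elim (fun k => Real.exp (-β k / 2)) (fun k => Real.exp (β k / 2)) with hr_def
  set c : Fin m → Fin d ⊕ Fin d → ℂ := fun i =>
    Sum.elim (fun k => (starRingEnd ℂ) (U i k) * w k)
      (fun k => V i k * (starRingEnd ℂ) (w k)) with hc_def
  have hr : ∀ s, 0 < r s := by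
    rintro (k | k) <;> exact Real.exp_pos _
  have hAc : ∀ t i, A t w i = ∑ s, (Real.exp (-(t * r s)) : ℂ) * c i s := by
    intro t i
    simp only [hA, Pi.add_apply, Matrix.mulVec, dotProduct, hP, hQ, Fintype.sum_sum_type, hr_def,
      hc_def, Sum.elim_inl, Sum.elim_inr, mul_assoc, Pi.star_apply, starRingEnd_apply]
  have hint : ∀ i, IntegrableOn (fun t => ‖A t w i‖ ^ 2) (Set.Ici 0) := by
    intro i
    simp_rw [hAc]
    exact integrableOn_norm_sq_sum_exp_mul r hr (c i)
  have hterm : ∀ j k, ((starRingEnd ℂ) (w j) * (M j k * w k + N j k * (starRingEnd ℂ) (w k))).re =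
      -2 * ∑ i, (((starRingEnd ℂ) (c i (.inl j)) * c i (.inl k)).re / (r (.inl j) + r (.inl k)) +
        ((starRingEnd ℂ) (c i (.inl j)) * c i (.inr k)).re / (r (.inl j) + r (.inr k)) +
        (((starRingEnd ℂ) (c i (.inr j)) * c i (.inl k)).re / (r (.inr j) + r (.inl k)) +
        ((starRingEnd ℂ) (c i (.inr j)) * c i (.inr k)).re / (r (.inr j) + r (.inr k)))) := by
    intro j k
    simp only [hr_def, hc_def, Sum.elim_inl, Sum.elim_inr, hM, hN, Matrix.mul_apply,
      Matrix.transpose_apply, Matrix.map_apply]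
    generalize Real.exp (-β j / 2) = a₁, Real.exp (-β k / 2) = a₂, Real.exp (β j / 2) = b₁,
      Real.exp (β k / 2) = b₂
    simp only [div_eq_mul_inv, ← Complex.ofReal_add, ← Complex.ofReal_inv]
    generalize (a₁ + a₂)⁻¹ = p₁, (b₁ + b₂)⁻¹ = p₂, (a₁ + b₂)⁻¹ = p₃, (b₁ + a₂)⁻¹ = p₄
    simp only [Finset.mul_sum, Finset.sum_mul, ← Finset.sum_sub_distrib, ← Finset.sum_add_distrib,
      Complex.re_sum]
    refine Finset.sum_congr rfl fun i _ => ?_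
    simp
    ring
  have hform : (∑ k, (starRingEnd ℂ) (w k) * T w k).re =
      -2 * ∫ t in Set.Ici (0 : ℝ), ∑ j, ‖A t w j‖ ^ 2 := by
    rw [integral_finsetSum _ fun i _ => hint i]
    simp_rw [hAc, integral_norm_sq_sum_exp_mul r hr, Fintype.sum_sum_type,
      ← Finset.sum_add_distrib]
    rw [Finset.sum_comm, Finset.mul_sum, Complex.re_sum]
    refine Finset.sum_congr rfl fun j _ => ?_
    rw [Finset.sum_comm, Finset.mul_sum]
    simp_rw [← hterm, ← Complex.re_sum, ← Finset.mul_sum]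
    simp only [hT, Pi.add_apply, Matrix.mulVec, dotProduct, Finset.sum_add_distrib, Pi.star_apply,
      starRingEnd_apply]
  have hnonneg : ∀ t, 0 ≤ ∑ j, ‖A t w j‖ ^ 2 := fun t => by positivity
  have hcont : Continuous fun t => ∑ j, ‖A t w j‖ ^ 2 := by
    simp_rw [hAc]
    fun_prop
  refine ⟨hform, ?_, ?_⟩
  · rw [hform]
    have : 0 ≤ ∫ t in Set.Ici (0 : ℝ), ∑ j, ‖A t w j‖ ^ 2 := integral_nonneg hnonneg
    linarith
  · rw [hform, mul_eq_zero_iff_left (by norm_num), setIntegral_Ici_eq_zero_iff hcont hnonneg 0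
      (integrable_finsetSum _ fun i _ => hint i)]
    refine forall₂_congr fun t _ => ?_
    rw [Finset.sum_eq_zero_iff_of_nonneg fun _ _ => by positivity, funext_iff]
    simp
end

section
/- Let β_1,…,β_d > 0 and let U = [u_{jk}], V = [v_{jk}] be complex m×d matrices. For t ≥ 0 define A_t : ℂ^d → ℂ^m by A_t z = P_t z + Q_t z̄, where (P_t)_{jk} = exp(−t e^{−β_k/2}) · conj(u_{jk}) and (Q_t)_{jk} = exp(−t e^{β_k/2}) · v_{jk}. Let I_1,…,I_l be the partition of {1,…,d} into the classes on which β is constant, and for each n let U_n, V_n be the m×|I_n| submatrices of U, V formed by the columns indexed by I_n. Then for w ∈ ℂ^d, A_t w = 0 for all t ≥ 0 if and only if for every n ∈ {1,…,l} the vector w̄ restricted to the indices I_n lies in ker U_n ∩ ker V_n, i.e. for all n and all 1 ≤ j ≤ m, ∑_{k ∈ I_n} conj(u_{jk}) w_k = 0 and ∑_{k ∈ I_n} v_{jk} conj(w_k) = 0. -/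
open Matrix Complex

/-- If all power sums `∑ i, c i * x i ^ n` vanish, then so does the total weight `c` carried by
each value of `x`. -/
theorem sum_filter_eq_zero_of_forall_sum_mul_pow_eq_zero {ι R : Type*} [Fintype ι] [CommRing R]
    [IsDomain R] [DecidableEq R] (x c : ι → R) (h : ∀ n : ℕ, ∑ i, c i * x i ^ n = 0) (r : R) :
    ∑ i with x i = r, c i = 0 := by
  have hpoly (p : Polynomial R) : ∑ i, c i * p.eval (x i) = 0 := by
    simp_rw [Polynomial.eval_eq_sum_range, Finset.mul_sum]
    rw [Finset.sum_comm]
    refine Finset.sum_eq_zero fun n _ => ?_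
    rw [← mul_zero (p.coeff n), ← h n, Finset.mul_sum]
    exact Finset.sum_congr rfl fun i _ => by ring
  set s := (Finset.univ.image x).erase r with hs
  set p : Polynomial R := ∏ y ∈ s, (Polynomial.X - Polynomial.C y) with hp
  have hr : p.eval r ≠ 0 := by
    rw [hp, Polynomial.eval_prod, Finset.prod_ne_zero_iff]
    intro y hy
    simpa [sub_eq_zero] using (Finset.ne_of_mem_erase hy).symm
  have hx (i : ι) (hi : x i ≠ r) : p.eval (x i) = 0 := by
    rw [hp, Polynomial.eval_prod]
    exact Finset.prod_eq_zero (i := x i) (by simp [hs, hi]) (by simp)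
  refine (mul_eq_zero.mp ?_).resolve_right hr
  rw [Finset.sum_mul, Finset.sum_filter]
  refine (Finset.sum_congr rfl fun i _ => ?_).trans (hpoly p)
  split_ifs with hi
  · rw [hi]
  · rw [hx i hi, mul_zero]

/-- A weight with vanishing sum over every fibre of `b` is annihilated by every function
of `b`. -/
theorem sum_comp_mul_eq_zero {ι κ R : Type*} [Fintype ι] [DecidableEq κ]
    [NonUnitalNonAssocSemiring R] (b : ι → κ) (c : ι → R)
    (h : ∀ i₀, ∑ i with b i = b i₀, c i = 0) (f : κ → R) : ∑ i, f (b i) * c i = 0 := by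
  rw [← Finset.sum_fiberwise_of_maps_to (fun i _ => Finset.mem_image_of_mem b (Finset.mem_univ i))]
  refine Finset.sum_eq_zero fun y hy => ?_
  obtain ⟨i₀, -, rfl⟩ := Finset.mem_image.mp hy
  rw [← mul_zero (f (b i₀)), ← h i₀, Finset.mul_sum]
  exact Finset.sum_congr rfl fun i hi => by rw [(Finset.mem_filter.mp hi).2]

/-- `A_t w = 0` for all `t ≥ 0` iff, on each class of indices with equal
inverse temperature, `w` (conjugated appropriately) is annihilated by the corresponding
column-submatrices of `U` and `V`. -/
theorem stmt8 (d m : ℕ) (β : Fin d → ℝ) (hβ : ∀ j, 0 < β j)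
    (U V : Matrix (Fin m) (Fin d) ℂ)
    (P Q : ℝ → Matrix (Fin m) (Fin d) ℂ)
    (hP : ∀ t j k, P t j k = (Real.exp (-(t * Real.exp (-β k / 2))) : ℂ) * (starRingEnd ℂ) (U j k))
    (hQ : ∀ t j k, Q t j k = (Real.exp (-(t * Real.exp (β k / 2))) : ℂ) * V j k)
    (A : ℝ → (Fin d → ℂ) → (Fin m → ℂ))
    (hA : ∀ t z, A t z = (P t).mulVec z + (Q t).mulVec (star z))
    (w : Fin d → ℂ) :
    (∀ t ≥ (0 : ℝ), A t w = 0) ↔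
      (∀ k₀ : Fin d, ∀ j : Fin m,
        (∑ k ∈ Finset.univ.filter (fun k => β k = β k₀), (starRingEnd ℂ) (U j k) * w k) = 0 ∧
        (∑ k ∈ Finset.univ.filter (fun k => β k = β k₀), V j k * (starRingEnd ℂ) (w k)) = 0) := by
  have hexpand (t : ℝ) (j : Fin m) : A t w j =
      ∑ k, (Real.exp (-(t * Real.exp (-β k / 2))) : ℂ) * ((starRingEnd ℂ) (U j k) * w k) +
      ∑ k, (Real.exp (-(t * Real.exp (β k / 2))) : ℂ) * (V j k * (starRingEnd ℂ) (w k)) := by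
    rw [hA, Pi.add_apply, mulVec, mulVec, dotProduct, dotProduct]
    simp only [hP, hQ, mul_assoc, Pi.star_apply, starRingEnd_apply]
  constructor
  · intro h k₀ j
    set c : Fin d ⊕ Fin d → ℂ := Sum.elim (fun k => (starRingEnd ℂ) (U j k) * w k)
      (fun k => V j k * (starRingEnd ℂ) (w k)) with hc
    set x : Fin d ⊕ Fin d → ℂ := Sum.elim (fun k => (Real.exp (-Real.exp (-β k / 2)) : ℂ))
      (fun k => (Real.exp (-Real.exp (β k / 2)) : ℂ)) with hx
    have hpow (a : ℝ) (n : ℕ) : (Real.exp (-((n : ℝ) * a)) : ℂ) = (Real.exp (-a) : ℂ) ^ n := by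
      rw [← Complex.ofReal_pow, ← Real.exp_nat_mul, mul_neg]
    have hsum (n : ℕ) : ∑ i, c i * x i ^ n = 0 := by
      have h0 := congrFun (h n n.cast_nonneg) j
      rw [hexpand] at h0
      simp only [hpow, Pi.zero_apply] at h0
      simp only [Fintype.sum_sum_type, hc, hx, Sum.elim_inl, Sum.elim_inr]
      simpa only [mul_comm] using h0
    have hne (k k' : Fin d) : -β k / 2 ≠ β k' / 2 := by
      have := hβ k
      have := hβ k'
      intro h
      linarith
    have hne' (k k' : Fin d) : β k / 2 ≠ -β k' / 2 := (hne k' k).symm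
    have h₁ := sum_filter_eq_zero_of_forall_sum_mul_pow_eq_zero x c hsum (x (.inl k₀))
    have h₂ := sum_filter_eq_zero_of_forall_sum_mul_pow_eq_zero x c hsum (x (.inr k₀))
    simp only [Finset.sum_filter, Fintype.sum_sum_type, hx, hc, Sum.elim_inl, Sum.elim_inr,
      Complex.ofReal_inj, Real.exp_eq_exp, neg_inj, hne, hne', if_false, Finset.sum_const_zero,
      add_zero, zero_add, div_left_inj' (two_ne_zero' ℝ)] at h₁ h₂
    simp only [Finset.sum_filter]
    exact ⟨h₁, h₂⟩
  · intro h t _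
    funext j
    rw [hexpand, sum_comp_mul_eq_zero β _ (fun k₀ => (h k₀ j).1)
        (fun b => (Real.exp (-(t * Real.exp (-b / 2))) : ℂ)),
      sum_comp_mul_eq_zero β _ (fun k₀ => (h k₀ j).2)
        (fun b => (Real.exp (-(t * Real.exp (b / 2))) : ℂ)), add_zero, Pi.zero_apply]
end

section
/- Let β_1,…,β_d > 0 and let U, V be complex m×d matrices. Define the real-linear operator T on ℂ^d by T z = M z + N z̄, where M_{jk} = −2 (UᵀŪ)_{jk} / ( e^{−β_j/2} + e^{−β_k/2} ) − 2 (VᵀV̄)_{jk} / ( e^{β_j/2} + e^{β_k/2} ) and N_{jk} = −2 (UᵀV)_{jk} / ( e^{−β_j/2} + e^{β_k/2} ) − 2 (VᵀU)_{jk} / ( e^{β_j/2} + e^{−β_k/2} ). Let I_1,…,I_l be the partition of {1,…,d} into the classes on which β is constant, and for each n let U_n, V_n be the m×|I_n| submatrices of U, V formed by the columns indexed by I_n. Then T is injective (i.e. T w = 0 implies w = 0) if and only if for every n ∈ {1,…,l}, the only x ∈ ℂ^{I_n} with U_n x = 0 and V_n x = 0 is x = 0. -/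
open Matrix Complex

section CauchyForm

lemma integrableOn_term {ι : Type*} {s : ι → ℝ} (hs : ∀ i, 0 < s i) (c : ι → ℂ)
    (i j : ι) :
    MeasureTheory.IntegrableOn
      (fun t : ℝ => (star (c i) * c j).re * Real.exp (-(s i + s j) * t)) (Set.Ioi 0) :=
  (integrableOn_exp_mul_Ioi (by linarith [hs i, hs j]) 0).const_mul _

variable {ι : Type*} [Fintype ι]

/-- The quadratic form of the Cauchy kernel `1 / (s i + s j)`. -/
noncomputable def cauchyForm (s : ι → ℝ) (c : ι → ℂ) : ℝ :=
  ∑ i, ∑ j, (star (c i) * c j).re / (s i + s j)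

/-- The exponential sum with exponents `s` and coefficients `c`. -/
noncomputable def expSum (s : ι → ℝ) (c : ι → ℂ) (t : ℝ) : ℂ :=
  ∑ i, c i * (Real.exp (-s i * t) : ℂ)

lemma continuous_expSum (s : ι → ℝ) (c : ι → ℂ) : Continuous (expSum s c) := by
  unfold expSum
  fun_prop

lemma normSq_expSum (s : ι → ℝ) (c : ι → ℂ) (t : ℝ) :
    normSq (expSum s c t) =
      ∑ i, ∑ j, (star (c i) * c j).re * Real.exp (-(s i + s j) * t) := by
  have h : ((normSq (expSum s c t) : ℝ) : ℂ) =
      ∑ i, ∑ j, (star (c i) * c j) * (Real.exp (-(s i + s j) * t) : ℂ) := by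
    rw [normSq_eq_conj_mul_self]
    simp only [expSum, map_sum, map_mul, conj_ofReal, Finset.sum_mul_sum]
    refine Finset.sum_congr rfl fun i _ => Finset.sum_congr rfl fun j _ => ?_
    rw [show -(s i + s j) * t = -s i * t + -s j * t by ring, Real.exp_add, ofReal_mul,
      starRingEnd_apply]
    ring
  have h' := congrArg Complex.re h
  simpa only [ofReal_re, re_sum, re_mul_ofReal] using h'

lemma integral_normSq_expSum {s : ι → ℝ} (hs : ∀ i, 0 < s i) (c : ι → ℂ) :
    ∫ t in Set.Ioi (0 : ℝ), normSq (expSum s c t) = cauchyForm s c := by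
  simp only [normSq_expSum, cauchyForm]
  rw [MeasureTheory.integral_finsetSum _ fun i _ =>
    MeasureTheory.integrable_finsetSum _ fun j _ => integrableOn_term hs c i j]
  refine Finset.sum_congr rfl fun i _ => ?_
  rw [MeasureTheory.integral_finsetSum _ fun j _ => integrableOn_term hs c i j]
  refine Finset.sum_congr rfl fun j _ => ?_
  have hij : -(s i + s j) < 0 := by linarith [hs i, hs j]
  rw [MeasureTheory.integral_const_mul, integral_exp_mul_Ioi hij]
  simp only [mul_zero, Real.exp_zero]
  rw [neg_div_neg_eq, mul_one_div]

lemma cauchyForm_nonneg {s : ι → ℝ} (hs : ∀ i, 0 < s i) (c : ι → ℂ) : 0 ≤ cauchyForm s c := by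
  rw [← integral_normSq_expSum hs]
  exact MeasureTheory.integral_nonneg fun t => normSq_nonneg _

lemma expSum_eq_zero_of_cauchyForm_eq_zero {s : ι → ℝ} (hs : ∀ i, 0 < s i) {c : ι → ℂ}
    (h : cauchyForm s c = 0) {t : ℝ} (ht : 0 < t) : expSum s c t = 0 := by
  have hint : MeasureTheory.IntegrableOn (fun t => normSq (expSum s c t)) (Set.Ioi 0) := by
    simp only [normSq_expSum]
    exact MeasureTheory.integrable_finsetSum _ fun i _ =>
      MeasureTheory.integrable_finsetSum _ fun j _ => integrableOn_term hs c i j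
  rw [← integral_normSq_expSum hs,
    MeasureTheory.integral_eq_zero_iff_of_nonneg (fun t => normSq_nonneg _) hint] at h
  have hcont : Continuous fun t => normSq (expSum s c t) :=
    continuous_normSq.comp (continuous_expSum s c)
  have := MeasureTheory.Measure.eqOn_open_of_ae_eq h isOpen_Ioi hcont.continuousOn
    continuousOn_const
  exact normSq_eq_zero.mp (this ht)

/-- Exponentials with distinct exponents are linearly independent. -/
lemma sum_coeff_eq_zero_of_expSum_eq_zero {s : ι → ℝ} {c : ι → ℂ}
    (h : ∀ t : ℝ, 0 < t → expSum s c t = 0) (v : ℝ) : ∑ i with s i = v, c i = 0 := by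
  classical
  have hpoly (P : Polynomial ℂ) :
      ∑ i, c i * ((Real.exp (-s i) : ℂ) * P.eval (Real.exp (-s i) : ℂ)) = 0 := by
    induction P using Polynomial.induction_on' with
    | add P Q hP hQ =>
      simp only [Polynomial.eval_add, mul_add, Finset.sum_add_distrib, hP, hQ, add_zero]
    | monomial n a =>
      have hn := h (n + 1) (by positivity)
      rw [← mul_zero a, ← hn, expSum, Finset.mul_sum]
      refine Finset.sum_congr rfl fun i _ => ?_
      rw [Polynomial.eval_monomial, show -s i * ((n : ℝ) + 1) = (n + 1 : ℕ) * -s i by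
        push_cast; ring, Real.exp_nat_mul]
      push_cast
      ring
  let E : ι → ℂ := fun i => (Real.exp (-s i) : ℂ)
  let e : ℂ := (Real.exp (-v) : ℂ)
  have hE (i : ι) : E i = e ↔ s i = v := by
    simp only [E, e, ofReal_inj, Real.exp_eq_exp, neg_inj]
  let P : Polynomial ℂ := ∏ i with s i ≠ v, (Polynomial.X - Polynomial.C (E i))
  have hP0 (i : ι) (hi : s i ≠ v) : P.eval (E i) = 0 := by
    rw [Polynomial.eval_prod]
    exact Finset.prod_eq_zero (i := i) (by simpa using hi) (by simp)
  have hPv : P.eval e ≠ 0 := by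
    rw [Polynomial.eval_prod, Finset.prod_ne_zero_iff]
    intro i hi
    have hi : s i ≠ v := by simpa using hi
    simpa [sub_eq_zero] using fun h => hi ((hE i).1 h.symm)
  have hsum : (∑ i with s i = v, c i) * (e * P.eval e) = 0 := by
    rw [← hpoly P, Finset.sum_filter, Finset.sum_mul]
    refine Finset.sum_congr rfl fun i _ => ?_
    by_cases hi : s i = v
    · simp [hi, e]
    · simp only [hi, if_false, zero_mul]
      rw [show P.eval (Real.exp (-s i) : ℂ) = 0 from hP0 i hi]
      simp
  refine (mul_eq_zero.mp hsum).resolve_right (mul_ne_zero ?_ hPv)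
  exact ofReal_ne_zero.mpr (Real.exp_ne_zero _)

end CauchyForm

/-- The exponents `e^{-β_k/2}` and `e^{β_k/2}`. -/
noncomputable def boltzmannExponent {d : ℕ} (β : Fin d → ℝ) : Fin d ⊕ Fin d → ℝ :=
  Sum.elim (fun k => Real.exp (-β k / 2)) (fun k => Real.exp (β k / 2))

lemma boltzmannExponent_pos {d : ℕ} (β : Fin d → ℝ) (i : Fin d ⊕ Fin d) :
    0 < boltzmannExponent β i := by
  cases i <;> exact Real.exp_pos _

/-- The coefficients of the exponential sum attached to the `l`-th rows of `U` and `V`. -/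
noncomputable def krausCoeff {d m : ℕ} (U V : Matrix (Fin m) (Fin d) ℂ) (w : Fin d → ℂ)
    (l : Fin m) : Fin d ⊕ Fin d → ℂ :=
  Sum.elim (fun k => star (U l k) * w k) (fun k => V l k * star (w k))

/-- The real part of `⟨w, T w⟩` is minus twice a sum of Cauchy forms. -/
lemma re_sum_star_mul_eq_cauchyForm {d m : ℕ} (β : Fin d → ℝ)
    (U V : Matrix (Fin m) (Fin d) ℂ) (M N : Matrix (Fin d) (Fin d) ℂ)
    (hM : ∀ j k, M j k =
      -2 * (Uᵀ * U.map (starRingEnd ℂ)) j k /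
          ((Real.exp (-β j / 2) : ℂ) + (Real.exp (-β k / 2) : ℂ)) -
        2 * (Vᵀ * V.map (starRingEnd ℂ)) j k /
          ((Real.exp (β j / 2) : ℂ) + (Real.exp (β k / 2) : ℂ)))
    (hN : ∀ j k, N j k =
      -2 * (Uᵀ * V) j k /
          ((Real.exp (-β j / 2) : ℂ) + (Real.exp (β k / 2) : ℂ)) -
        2 * (Vᵀ * U) j k /
          ((Real.exp (β j / 2) : ℂ) + (Real.exp (-β k / 2) : ℂ)))
    (w : Fin d → ℂ) :
    (∑ j, star (w j) * (M.mulVec w + N.mulVec (star w)) j).re =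
      -2 * ∑ l, cauchyForm (boltzmannExponent β) (krausCoeff U V w l) := by
  have hR : ∑ l, cauchyForm (boltzmannExponent β) (krausCoeff U V w l) =
      ∑ j, ∑ k, ∑ l,
        ((star (star (U l j) * w j) * (star (U l k) * w k)).re /
            (Real.exp (-β j / 2) + Real.exp (-β k / 2)) +
          (star (star (U l j) * w j) * (V l k * star (w k))).re /
            (Real.exp (-β j / 2) + Real.exp (β k / 2)) +
          ((star (V l j * star (w j)) * (star (U l k) * w k)).re /
            (Real.exp (β j / 2) + Real.exp (-β k / 2)) +
          (star (V l j * star (w j)) * (V l k * star (w k))).re /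
            (Real.exp (β j / 2) + Real.exp (β k / 2)))) := by
    simp only [cauchyForm, boltzmannExponent, krausCoeff, Fintype.sum_sum_type, Sum.elim_inl,
      Sum.elim_inr, ← Finset.sum_add_distrib]
    rw [Finset.sum_comm]
    exact Finset.sum_congr rfl fun j _ => Finset.sum_comm
  rw [hR]
  simp only [Pi.add_apply, mulVec, dotProduct, ← Finset.sum_add_distrib, Finset.mul_sum, re_sum]
  refine Finset.sum_congr rfl fun j _ => Finset.sum_congr rfl fun k _ => ?_
  rw [hM, hN]
  simp only [mul_apply, ← ofReal_add, div_eq_mul_inv, ← ofReal_inv]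
  generalize (Real.exp (-β j / 2) + Real.exp (-β k / 2))⁻¹ = a
  generalize (Real.exp (-β j / 2) + Real.exp (β k / 2))⁻¹ = b
  generalize (Real.exp (β j / 2) + Real.exp (-β k / 2))⁻¹ = c
  generalize (Real.exp (β j / 2) + Real.exp (β k / 2))⁻¹ = e
  simp only [Finset.mul_sum, Finset.sum_mul, ← Finset.sum_sub_distrib, ← Finset.sum_add_distrib,
    re_sum]
  refine Finset.sum_congr rfl fun l _ => ?_
  simp only [transpose_apply, map_apply, Pi.star_apply, star_def, map_mul, conj_conj, mul_re,
    mul_im, add_re, add_im, sub_re, sub_im, neg_re, neg_im, re_ofNat, im_ofNat, ofReal_re,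
    ofReal_im, conj_re, conj_im]
  ring

lemma exp_neg_half_lt_exp_half {a b : ℝ} (ha : 0 < a) (hb : 0 < b) :
    Real.exp (-a / 2) < Real.exp (b / 2) :=
  Real.exp_lt_exp.mpr (by linarith)

lemma sum_div_eq_zero_of_mulVec_eq_zero {d m : ℕ} {A : Matrix (Fin m) (Fin d) ℂ}
    {x : Fin d → ℂ} (hA : A.mulVec x = 0) {β : Fin d → ℝ} {b : ℝ}
    (hx : ∀ k, β k ≠ b → x k = 0) (y : Fin m → ℂ) (g : ℝ → ℂ) :
    ∑ k, (∑ l, y l * A l k) / g (β k) * x k = 0 := by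
  calc ∑ k, (∑ l, y l * A l k) / g (β k) * x k
      = ∑ k, ∑ l, y l / g b * (A l k * x k) := by
        refine Finset.sum_congr rfl fun k _ => ?_
        by_cases hk : β k = b
        · rw [hk, Finset.sum_div, Finset.sum_mul]
          exact Finset.sum_congr rfl fun l _ => by ring
        · simp [hx k hk]
    _ = ∑ l, y l / g b * A.mulVec x l := by
        rw [Finset.sum_comm]
        simp only [mulVec, dotProduct, Finset.mul_sum]
    _ = 0 := by simp [hA]

/-- The real-linear operator `T = Z^♯ D_csch + D_csch Z` is injective iff,
for every class of indices with equal inverse temperature, the corresponding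
column-submatrices of `U` and `V` have trivial common kernel. -/
theorem stmt9 (d m : ℕ) (β : Fin d → ℝ) (hβ : ∀ j, 0 < β j)
    (U V : Matrix (Fin m) (Fin d) ℂ)
    (M N : Matrix (Fin d) (Fin d) ℂ)
    (hM : ∀ j k, M j k =
      -2 * (Uᵀ * U.map (starRingEnd ℂ)) j k /
          ((Real.exp (-β j / 2) : ℂ) + (Real.exp (-β k / 2) : ℂ)) -
        2 * (Vᵀ * V.map (starRingEnd ℂ)) j k /
          ((Real.exp (β j / 2) : ℂ) + (Real.exp (β k / 2) : ℂ)))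
    (hN : ∀ j k, N j k =
      -2 * (Uᵀ * V) j k /
          ((Real.exp (-β j / 2) : ℂ) + (Real.exp (β k / 2) : ℂ)) -
        2 * (Vᵀ * U) j k /
          ((Real.exp (β j / 2) : ℂ) + (Real.exp (-β k / 2) : ℂ)))
    (T : (Fin d → ℂ) → (Fin d → ℂ))
    (hT : ∀ z, T z = M.mulVec z + N.mulVec (star z)) :
    (∀ w : Fin d → ℂ, T w = 0 → w = 0) ↔
      (∀ k₀ : Fin d, ∀ x : Fin d → ℂ,
        (∀ k, β k ≠ β k₀ → x k = 0) → U.mulVec x = 0 → V.mulVec x = 0 → x = 0) := by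
  constructor
  · intro hinj k₀ x hx hU hV
    have hUc : (U.map (starRingEnd ℂ)).mulVec (star x) = 0 := by
      ext l
      simpa [mulVec, dotProduct] using congrArg star (congrFun hU l)
    have hVc : (V.map (starRingEnd ℂ)).mulVec (star x) = 0 := by
      ext l
      simpa [mulVec, dotProduct] using congrArg star (congrFun hV l)
    have hxc : ∀ k, β k ≠ β k₀ → star x k = 0 := fun k hk => by simp [hx k hk]
    refine star_eq_zero.mp (hinj _ ?_)
    rw [hT, star_star]
    ext j
    have h₁ := sum_div_eq_zero_of_mulVec_eq_zero hUc hxc (fun l => U l j)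
      (fun b => (Real.exp (-β j / 2) : ℂ) + (Real.exp (-b / 2) : ℂ))
    have h₂ := sum_div_eq_zero_of_mulVec_eq_zero hVc hxc (fun l => V l j)
      (fun b => (Real.exp (β j / 2) : ℂ) + (Real.exp (b / 2) : ℂ))
    have h₃ := sum_div_eq_zero_of_mulVec_eq_zero hV hx (fun l => U l j)
      (fun b => (Real.exp (-β j / 2) : ℂ) + (Real.exp (b / 2) : ℂ))
    have h₄ := sum_div_eq_zero_of_mulVec_eq_zero hU hx (fun l => V l j)
      (fun b => (Real.exp (β j / 2) : ℂ) + (Real.exp (-b / 2) : ℂ))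
    simp only [Pi.add_apply, mulVec, dotProduct, hM, hN, mul_apply, transpose_apply, sub_mul,
      Finset.sum_sub_distrib, mul_div_assoc, mul_assoc, ← Finset.mul_sum] at h₁ h₂ h₃ h₄ ⊢
    rw [h₁, h₂, h₃, h₄]
    simp
  · intro hker w hw
    have hsum : ∑ l, cauchyForm (boltzmannExponent β) (krausCoeff U V w l) = 0 := by
      have h := re_sum_star_mul_eq_cauchyForm β U V M N hM hN w
      rw [← hT, hw] at h
      simpa using h.symm
    have hzero (l : Fin m) (v : ℝ) :
        ∑ i with boltzmannExponent β i = v, krausCoeff U V w l i = 0 := by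
      refine sum_coeff_eq_zero_of_expSum_eq_zero (fun t ht => ?_) v
      refine expSum_eq_zero_of_cauchyForm_eq_zero (boltzmannExponent_pos β) ?_ ht
      exact (Finset.sum_eq_zero_iff_of_nonneg fun l _ =>
        cauchyForm_nonneg (boltzmannExponent_pos β) _).mp hsum l (Finset.mem_univ l)
    ext k₀
    have hx := hker k₀ (fun k => if β k = β k₀ then star (w k) else 0)
      (fun k hk => by simp [hk]) ?_ ?_
    · simpa using congrFun hx k₀
    · ext l
      have h := hzero l (Real.exp (-β k₀ / 2))
      have hne (k : Fin d) : Real.exp (β k / 2) ≠ Real.exp (-β k₀ / 2) :=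
        (exp_neg_half_lt_exp_half (hβ k₀) (hβ k)).ne'
      have heq (k : Fin d) : Real.exp (-β k / 2) = Real.exp (-β k₀ / 2) ↔ β k = β k₀ := by
        rw [Real.exp_eq_exp]
        constructor <;> intro h <;> linarith
      rw [Finset.sum_filter, Fintype.sum_sum_type] at h
      simp only [boltzmannExponent, krausCoeff, Sum.elim_inl, Sum.elim_inr, hne, heq, if_false,
        Finset.sum_const_zero, add_zero] at h
      have h' := congrArg star h
      simpa [mulVec, dotProduct, apply_ite, mul_comm] using h'
    · ext l
      have h := hzero l (Real.exp (β k₀ / 2))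
      have hne (k : Fin d) : Real.exp (-β k / 2) ≠ Real.exp (β k₀ / 2) :=
        (exp_neg_half_lt_exp_half (hβ k) (hβ k₀)).ne
      have heq (k : Fin d) : Real.exp (β k / 2) = Real.exp (β k₀ / 2) ↔ β k = β k₀ := by
        rw [Real.exp_eq_exp]
        constructor <;> intro h <;> linarith
      rw [Finset.sum_filter, Fintype.sum_sum_type] at h
      simp only [boltzmannExponent, krausCoeff, Sum.elim_inl, Sum.elim_inr, hne, heq, if_false,
        Finset.sum_const_zero, zero_add] at h
      simpa [mulVec, dotProduct] using h
end

section
/- Let u, v, a, b, c be real numbers with v > u > 0 and a ≠ c. Let E be the 2×2 all-ones real matrix and Ω = [[a, b], [b, c]]. Then every eigenvalue of the real 4×4 matrix 𝐙 = [[ ((u² − v²)/2 − u v (v² − u²)/(v² + u²)) E , −Ω ], [ Ω , ((u² − v²)/2 + u v (v² − u²)/(v² + u²)) E ]] has strictly negative real part. -/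
open Matrix Complex

/-- Componentwise stability criterion: if the complex vector `(x₁, x₂, y₁, y₂)` is an eigenvector
of `[[p E, -Ω], [Ω, q E]]` with `p, q < 0` and `a ≠ c`, the eigenvalue has negative real part. -/
theorem re_neg_of_drift_eigenvector {p q a b c : ℝ} (hp : p < 0) (hq : q < 0) (hac : a ≠ c)
    {μ x₁ x₂ y₁ y₂ : ℂ} (h₁ : p * (x₁ + x₂) - (a * y₁ + b * y₂) = μ * x₁)
    (h₂ : p * (x₁ + x₂) - (b * y₁ + c * y₂) = μ * x₂)
    (h₃ : a * x₁ + b * x₂ + q * (y₁ + y₂) = μ * y₁)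
    (h₄ : b * x₁ + c * x₂ + q * (y₁ + y₂) = μ * y₂)
    (hne : ¬(x₁ = 0 ∧ x₂ = 0 ∧ y₁ = 0 ∧ y₂ = 0)) : μ.re < 0 := by
  -- The skew part of the matrix drops out of the real part of the quadratic form.
  have energy : μ.re * (normSq x₁ + normSq x₂ + normSq y₁ + normSq y₂) =
      p * normSq (x₁ + x₂) + q * normSq (y₁ + y₂) := by
    have r₁ := congrArg re h₁
    have r₂ := congrArg re h₂
    have r₃ := congrArg re h₃
    have r₄ := congrArg re h₄
    have i₁ := congrArg im h₁
    have i₂ := congrArg im h₂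
    have i₃ := congrArg im h₃
    have i₄ := congrArg im h₄
    simp only [add_re, add_im, sub_re, sub_im, mul_re, mul_im, ofReal_re, ofReal_im]
      at r₁ r₂ r₃ r₄ i₁ i₂ i₃ i₄
    simp only [normSq_apply, add_re, add_im]
    linear_combination -x₁.re * r₁ - x₁.im * i₁ - x₂.re * r₂ - x₂.im * i₂
      - y₁.re * r₃ - y₁.im * i₃ - y₂.re * r₄ - y₂.im * i₄
  by_contra! hμ
  have hlhs : 0 ≤ μ.re * (normSq x₁ + normSq x₂ + normSq y₁ + normSq y₂) :=
    mul_nonneg hμ (add_nonneg (add_nonneg (add_nonneg (normSq_nonneg x₁) (normSq_nonneg x₂))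
      (normSq_nonneg y₁)) (normSq_nonneg y₂))
  have hpx := mul_nonpos_of_nonpos_of_nonneg hp.le (normSq_nonneg (x₁ + x₂))
  have hqy := mul_nonpos_of_nonpos_of_nonneg hq.le (normSq_nonneg (y₁ + y₂))
  have hx : x₁ + x₂ = 0 :=
    normSq_eq_zero.1 ((mul_eq_zero.1 (by linarith : p * normSq (x₁ + x₂) = 0)).resolve_left hp.ne)
  have hy : y₁ + y₂ = 0 :=
    normSq_eq_zero.1 ((mul_eq_zero.1 (by linarith : q * normSq (y₁ + y₂) = 0)).resolve_left hq.ne)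
  have hac' : (a : ℂ) - c ≠ 0 := sub_ne_zero.2 (ofReal_injective.ne hac)
  have hx₁ : x₁ = 0 := (mul_eq_zero.1 (by
    linear_combination h₃ + h₄ + (μ - 2 * q) * hy - (b + c) * hx :
      ((a : ℂ) - c) * x₁ = 0)).resolve_left hac'
  have hy₁ : y₁ = 0 := (mul_eq_zero.1 (by
    linear_combination -h₁ - h₂ + (2 * p - μ) * hx - (b + c) * hy :
      ((a : ℂ) - c) * y₁ = 0)).resolve_left hac'
  exact hne ⟨hx₁, by simpa [hx₁] using hx, hy₁, by simpa [hy₁] using hy⟩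

/-- The drift matrix of the two-mode example (with `v > u > 0` and
`a ≠ c`) is stable: every (complex) eigenvalue has strictly negative real part. -/
theorem stmt11 (u v a b c : ℝ) (huv : u < v) (hu : 0 < u) (hac : a ≠ c)
    (E : Matrix (Fin 2) (Fin 2) ℝ) (hE : E = Matrix.of fun _ _ => 1)
    (Ω : Matrix (Fin 2) (Fin 2) ℝ) (hΩ : Ω = !![a, b; b, c])
    (Zm : Matrix (Fin 2 ⊕ Fin 2) (Fin 2 ⊕ Fin 2) ℝ)
    (hZ : Zm = Matrix.fromBlocks
      (((u ^ 2 - v ^ 2) / 2 - u * v * (v ^ 2 - u ^ 2) / (v ^ 2 + u ^ 2)) • E) (-Ω)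
      Ω (((u ^ 2 - v ^ 2) / 2 + u * v * (v ^ 2 - u ^ 2) / (v ^ 2 + u ^ 2)) • E)) :
    ∀ μ ∈ spectrum ℂ (Zm.map Complex.ofReal), μ.re < 0 := by
  intro μ hμ
  have huv_pos : 0 < v ^ 2 + u ^ 2 := by positivity
  have hdiff : 0 < v ^ 2 - u ^ 2 := by nlinarith
  have hratio : u * v * (v ^ 2 - u ^ 2) / (v ^ 2 + u ^ 2) < (v ^ 2 - u ^ 2) / 2 := by
    rw [div_lt_div_iff₀ huv_pos two_pos]
    nlinarith [mul_pos hdiff (pow_pos (sub_pos.2 huv) 2)]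
  have hratio_pos : 0 < u * v * (v ^ 2 - u ^ 2) / (v ^ 2 + u ^ 2) :=
    div_pos (mul_pos (mul_pos hu (hu.trans huv)) hdiff) huv_pos
  have hp : (u ^ 2 - v ^ 2) / 2 - u * v * (v ^ 2 - u ^ 2) / (v ^ 2 + u ^ 2) < 0 := by linarith
  have hq : (u ^ 2 - v ^ 2) / 2 + u * v * (v ^ 2 - u ^ 2) / (v ^ 2 + u ^ 2) < 0 := by linarith
  generalize (u ^ 2 - v ^ 2) / 2 - u * v * (v ^ 2 - u ^ 2) / (v ^ 2 + u ^ 2) = p at hZ hp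
  generalize (u ^ 2 - v ^ 2) / 2 + u * v * (v ^ 2 - u ^ 2) / (v ^ 2 + u ^ 2) = q at hZ hq
  rw [← Matrix.spectrum_toLin', ← Module.End.hasEigenvalue_iff_mem_spectrum] at hμ
  obtain ⟨w, hw⟩ := hμ.exists_hasEigenvector
  have heq : Zm.map Complex.ofReal *ᵥ w = μ • w := by
    simpa only [Matrix.toLin'_apply] using hw.apply_eq_smul
  subst hZ hE hΩ
  have h₁ := congrFun heq (Sum.inl 0)
  have h₂ := congrFun heq (Sum.inl 1)
  have h₃ := congrFun heq (Sum.inr 0)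
  have h₄ := congrFun heq (Sum.inr 1)
  simp [Matrix.mulVec, dotProduct] at h₁ h₂ h₃ h₄
  refine re_neg_of_drift_eigenvector hp hq hac (x₁ := w (Sum.inl 0)) (x₂ := w (Sum.inl 1))
    (y₁ := w (Sum.inr 0)) (y₂ := w (Sum.inr 1)) (b := b)
    (by linear_combination h₁) (by linear_combination h₂)
    (by linear_combination h₃) (by linear_combination h₄) ?_
  rintro ⟨hx₁, hx₂, hy₁, hy₂⟩
  apply hw.2
  ext i
  rcases i with i | i <;> fin_cases i <;> assumption
end

section
/- Let u, v, a, b, c be real numbers with v > u > 0. Let E be the 2×2 all-ones matrix and Ω = [[a, b], [b, c]]. Define real-linear operators Z and C on ℂ² by Z z = ( (u² − v²)/2 · E + iΩ ) z − ( u v (v² − u²)/(v² + u²) ) E z̄ and C z = (u² + v²) E z + 2 u v E z̄. Then: (i) the operator S = ((v² + u²)/(v² − u²)) · Id satisfies Z^♯ S + S Z = −C; (ii) the nonzero vector w = (1, −1) satisfies (Z^♯ + Z) w = 0, so that for every real s > 0 the operator Z^♯ (s·Id) + (s·Id) Z = s (Z^♯ + Z) has nontrivial kernel. -/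
open Matrix Complex

/-- For the two-mode example: (i) `S = ((v²+u²)/(v²−u²))·Id` solves the
Lyapunov equation `Z^♯ S + S Z = −C`; (ii) `w = (1,−1)` lies in the kernel of `Z^♯ + Z`, so
`Z^♯ (s·Id) + (s·Id) Z` has nontrivial kernel for every `s > 0`. -/
theorem stmt12 (u v a b c : ℝ) (huv : u < v) (hu : 0 < u)
    (E Ω : Matrix (Fin 2) (Fin 2) ℂ)
    (hE : E = Matrix.of fun _ _ => 1)
    (hΩ : Ω = !![(a : ℂ), (b : ℂ); (b : ℂ), (c : ℂ)])
    (Z₁ Z₂ C₁ C₂ : Matrix (Fin 2) (Fin 2) ℂ)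
    (hZ₁ : Z₁ = (((u ^ 2 - v ^ 2) / 2 : ℝ) : ℂ) • E + Complex.I • Ω)
    (hZ₂ : Z₂ = -(((u * v * (v ^ 2 - u ^ 2) / (v ^ 2 + u ^ 2) : ℝ)) : ℂ) • E)
    (hC₁ : C₁ = (((u ^ 2 + v ^ 2 : ℝ)) : ℂ) • E)
    (hC₂ : C₂ = ((2 * u * v : ℝ) : ℂ) • E)
    (Zop Zsharp Cop : (Fin 2 → ℂ) → (Fin 2 → ℂ))
    (hZop : ∀ z, Zop z = Z₁.mulVec z + Z₂.mulVec (star z))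
    (hZsharp : ∀ z, Zsharp z = Z₁ᴴ.mulVec z + Z₂ᵀ.mulVec (star z))
    (hCop : ∀ z, Cop z = C₁.mulVec z + C₂.mulVec (star z)) :
    (∀ z : Fin 2 → ℂ,
      Zsharp (((v ^ 2 + u ^ 2) / (v ^ 2 - u ^ 2) : ℝ) • z) +
        ((v ^ 2 + u ^ 2) / (v ^ 2 - u ^ 2) : ℝ) • Zop z = -(Cop z)) ∧
    ((![1, -1] : Fin 2 → ℂ) ≠ 0 ∧ Zsharp ![1, -1] + Zop ![1, -1] = 0) ∧
    (∀ s : ℝ, 0 < s → ∃ w : Fin 2 → ℂ, w ≠ 0 ∧ Zsharp (s • w) + s • Zop w = 0) := by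
  have hE' : E = !![1, 1; 1, 1] := by
    rw [hE]
    ext i j
    fin_cases i <;> fin_cases j <;> rfl
  have key : ∀ (s : ℝ) (z : Fin 2 → ℂ) (i : Fin 2), (Zsharp (s • z) + s • Zop z) i =
      ((s * (u ^ 2 - v ^ 2) : ℝ) : ℂ) * (z 0 + z 1) -
      ((s * (2 * (u * v * (v ^ 2 - u ^ 2) / (v ^ 2 + u ^ 2))) : ℝ) : ℂ) *
        (star (z 0) + star (z 1)) := by
    intro s z i
    rw [hZop, hZsharp, hZ₁, hZ₂, hE', hΩ]
    generalize u * v * (v ^ 2 - u ^ 2) / (v ^ 2 + u ^ 2) = k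
    fin_cases i <;>
    · simp [dotProduct, Fin.sum_univ_two]
      ring
  have hw : (![1, -1] : Fin 2 → ℂ) ≠ 0 := fun h => by simpa using congrFun h 0
  have hker : ∀ s : ℝ, Zsharp (s • ![1, -1]) + s • Zop ![1, -1] = 0 := by
    intro s
    ext i
    rw [key]
    simp
  refine ⟨fun z => ?_, ⟨hw, by simpa using hker 1⟩, fun s _ => ⟨_, hw, hker s⟩⟩
  have hsub : v ^ 2 - u ^ 2 ≠ 0 := by nlinarith
  have hadd : v ^ 2 + u ^ 2 ≠ 0 := by positivity
  have hdiag : (v ^ 2 + u ^ 2) / (v ^ 2 - u ^ 2) * (u ^ 2 - v ^ 2) = -(u ^ 2 + v ^ 2) := by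
    field_simp
    ring
  have hconj : (v ^ 2 + u ^ 2) / (v ^ 2 - u ^ 2) *
      (2 * (u * v * (v ^ 2 - u ^ 2) / (v ^ 2 + u ^ 2))) = 2 * u * v := by
    field_simp
  ext i
  rw [key, hdiag, hconj, hCop, hC₁, hC₂, hE']
  fin_cases i <;>
  · simp [vecHead, vecTail]
    ring
end

section
/- Let λ, μ, ω be real numbers and set c = μ/(4ω² + 1) and s = 2ωμ/(4ω² + 1). Then the characteristic polynomial of the complex 3×3 matrix [[ i(λ + c) , s , 0 ], [ −s , iλ , s ], [ 0 , −s , i(λ − c) ]] equals (X − iλ) (X − iλ − i μ r) (X − iλ + i μ r), where r = √(8ω² + 1)/(4ω² + 1); in particular its eigenvalues are iλ, iλ + iμr and iλ − iμr. -/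
open Matrix Complex Polynomial

/-- The characteristic polynomial of the `3×3` matrix arising in the
boson chain model factors as `(X − iλ)(X − iλ − iμr)(X − iλ + iμr)` with
`r = √(8ω²+1)/(4ω²+1)`, so its eigenvalues are `iλ, iλ ± iμr`. -/
theorem stmt15 (lam mu ω : ℝ)
    (c s : ℝ) (hc : c = mu / (4 * ω ^ 2 + 1)) (hs : s = 2 * ω * mu / (4 * ω ^ 2 + 1))
    (r : ℝ) (hr : r = Real.sqrt (8 * ω ^ 2 + 1) / (4 * ω ^ 2 + 1))
    (A : Matrix (Fin 3) (Fin 3) ℂ)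
    (hA : A = !![Complex.I * ((lam : ℂ) + (c : ℂ)), (s : ℂ), 0;
                 -(s : ℂ), Complex.I * (lam : ℂ), (s : ℂ);
                 0, -(s : ℂ), Complex.I * ((lam : ℂ) - (c : ℂ))]) :
    A.charpoly =
      (X - Polynomial.C (Complex.I * (lam : ℂ))) *
        (X - Polynomial.C (Complex.I * (lam : ℂ) + Complex.I * (mu : ℂ) * (r : ℂ))) *
        (X - Polynomial.C (Complex.I * (lam : ℂ) - Complex.I * (mu : ℂ) * (r : ℂ))) ∧
    (∀ z : ℂ, z ∈ spectrum ℂ A ↔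
      z = Complex.I * (lam : ℂ) ∨
      z = Complex.I * (lam : ℂ) + Complex.I * (mu : ℂ) * (r : ℂ) ∨
      z = Complex.I * (lam : ℂ) - Complex.I * (mu : ℂ) * (r : ℂ)) := by
  have hreal : c ^ 2 + 2 * s ^ 2 = mu ^ 2 * r ^ 2 := by
    have hd : 4 * ω ^ 2 + 1 ≠ 0 := by positivity
    rw [hr, div_pow, Real.sq_sqrt (by positivity), hc, hs]
    field_simp
    ring
  have key : (c : ℂ) ^ 2 + 2 * (s : ℂ) ^ 2 = (mu : ℂ) ^ 2 * (r : ℂ) ^ 2 := by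
    exact_mod_cast hreal
  have keyC : (C (c : ℂ) : ℂ[X]) ^ 2 + 2 * C (s : ℂ) ^ 2 = C (mu : ℂ) ^ 2 * C (r : ℂ) ^ 2 := by
    simpa only [map_add, map_mul, map_pow, map_ofNat] using congrArg (C : ℂ → ℂ[X]) key
  have hI : (C Complex.I : ℂ[X]) ^ 2 = -1 := by
    rw [← C_pow, Complex.I_sq, C_neg, C_1]
  have hchar : A.charpoly =
      (X - Polynomial.C (Complex.I * (lam : ℂ))) *
        (X - Polynomial.C (Complex.I * (lam : ℂ) + Complex.I * (mu : ℂ) * (r : ℂ))) *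
        (X - Polynomial.C (Complex.I * (lam : ℂ) - Complex.I * (mu : ℂ) * (r : ℂ))) := by
    rw [hA, Matrix.charpoly, Matrix.det_fin_three]
    simp only [charmatrix_apply, diagonal_apply, of_apply, cons_val', cons_val_zero, cons_val_one,
      cons_val, Fin.isValue, Fin.reduceEq, if_true, if_false, map_add, map_sub, map_mul, map_neg,
      map_zero]
    linear_combination (X - C Complex.I * C (lam : ℂ)) * keyC +
      (X - C Complex.I * C (lam : ℂ)) *
        (C (mu : ℂ) ^ 2 * C (r : ℂ) ^ 2 - C (c : ℂ) ^ 2) * hI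
  refine ⟨hchar, fun z => ?_⟩
  rw [Matrix.mem_spectrum_iff_isRoot_charpoly, hchar]
  simp only [IsRoot.def, eval_mul, eval_sub, eval_X, eval_C, mul_eq_zero, sub_eq_zero, or_assoc]
end

section
/- Let ω be a real number. Define the real 3×3 matrices D₁ = diag(1, 0, 1), D₂ = diag(−1, 0, 1), P = [[0,1,0],[1,0,1],[0,1,0]], Y = [[0,−ω,0],[ω,0,−ω],[0,ω,0]], and the real 6×6 matrices 𝐙 = [[ −(1/2) D₁ , −ω P ], [ ω P , −(1/2) D₁ ]], 𝐒_δ = (2/(4ω² + 1)) [[ −(1/2) D₂ , Y ], [ −Y , −(1/2) D₂ ]], 𝐂₁ = diag(1,0,1,1,0,1), 𝐂_δ = diag(1,0,−1,1,0,−1). Then 𝐙ᵀ + 𝐙 = −𝐂₁ and 𝐙ᵀ 𝐒_δ + 𝐒_δ 𝐙 = −𝐂_δ; consequently, for all real λ, μ, the matrix 𝐒 = λ I₆ + μ 𝐒_δ satisfies the Lyapunov equation 𝐙ᵀ 𝐒 + 𝐒 𝐙 = −(λ 𝐂₁ + μ 𝐂_δ). -/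
open Matrix

theorem diagonal_vec_three {R : Type*} [Zero R] (a b c : R) :
    Matrix.diagonal ![a, b, c] = !![a, 0, 0; 0, b, 0; 0, 0, c] := by
  ext i j
  fin_cases i <;> fin_cases j <;> rfl

/-- Lyapunov equations for the three-mode boson chain model:
`𝐙ᵀ + 𝐙 = −𝐂₁`, `𝐙ᵀ 𝐒_δ + 𝐒_δ 𝐙 = −𝐂_δ`, hence `𝐒 = λI + μ𝐒_δ` satisfies
`𝐙ᵀ 𝐒 + 𝐒 𝐙 = −(λ𝐂₁ + μ𝐂_δ)`. -/
theorem stmt16 (ω : ℝ)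
    (D₁ D₂ P Y : Matrix (Fin 3) (Fin 3) ℝ)
    (hD₁ : D₁ = Matrix.diagonal ![1, 0, 1])
    (hD₂ : D₂ = Matrix.diagonal ![-1, 0, 1])
    (hP : P = !![0, 1, 0; 1, 0, 1; 0, 1, 0])
    (hY : Y = !![0, -ω, 0; ω, 0, -ω; 0, ω, 0])
    (Z Sδ C₁ Cδ : Matrix (Fin 3 ⊕ Fin 3) (Fin 3 ⊕ Fin 3) ℝ)
    (hZ : Z = Matrix.fromBlocks (-((1 : ℝ) / 2) • D₁) (-(ω • P)) (ω • P) (-((1 : ℝ) / 2) • D₁))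
    (hSδ : Sδ = (2 / (4 * ω ^ 2 + 1)) •
      Matrix.fromBlocks (-((1 : ℝ) / 2) • D₂) Y (-Y) (-((1 : ℝ) / 2) • D₂))
    (hC₁ : C₁ = Matrix.fromBlocks D₁ 0 0 D₁)
    (hCδ : Cδ = Matrix.fromBlocks (Matrix.diagonal ![1, 0, -1]) 0 0 (Matrix.diagonal ![1, 0, -1])) :
    Zᵀ + Z = -C₁ ∧
    Zᵀ * Sδ + Sδ * Z = -Cδ ∧
    (∀ lam mu : ℝ,
      Zᵀ * (lam • (1 : Matrix (Fin 3 ⊕ Fin 3) (Fin 3 ⊕ Fin 3) ℝ) + mu • Sδ) +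
        (lam • (1 : Matrix (Fin 3 ⊕ Fin 3) (Fin 3 ⊕ Fin 3) ℝ) + mu • Sδ) * Z =
        -(lam • C₁ + mu • Cδ)) := by
  rw [diagonal_vec_three] at hD₁ hD₂ hCδ
  have hsym : Zᵀ + Z = -C₁ := by
    subst hZ hC₁ hD₁ hP
    rw [Matrix.fromBlocks_transpose, Matrix.fromBlocks_add, Matrix.fromBlocks_neg,
      Matrix.fromBlocks_inj]
    refine ⟨?_, ?_, ?_, ?_⟩ <;> ext i j <;> fin_cases i <;> fin_cases j <;> norm_num
  have hdelta : Zᵀ * Sδ + Sδ * Z = -Cδ := by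
    have hω : 4 * ω ^ 2 + 1 ≠ 0 := by positivity
    subst hZ hSδ hCδ hD₁ hD₂ hP hY
    rw [Matrix.mul_smul, Matrix.smul_mul, ← smul_add, Matrix.fromBlocks_transpose,
      Matrix.fromBlocks_multiply, Matrix.fromBlocks_multiply, Matrix.fromBlocks_add,
      Matrix.fromBlocks_smul, Matrix.fromBlocks_neg, Matrix.fromBlocks_inj]
    refine ⟨?_, ?_, ?_, ?_⟩ <;> ext i j <;> fin_cases i <;> fin_cases j <;>
      simp [Matrix.mul_apply, Fin.sum_univ_three] <;> field_simp <;> ring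
  refine ⟨hsym, hdelta, fun lam mu => ?_⟩
  calc
    _ = lam • (Zᵀ + Z) + mu • (Zᵀ * Sδ + Sδ * Z) := by
      simp only [mul_add, add_mul, Matrix.mul_smul, Matrix.smul_mul, mul_one, one_mul, smul_add]
      abel
    _ = _ := by rw [hsym, hdelta, smul_neg, smul_neg, neg_add]
end

section
/- Let ω be a nonzero real number, D₁ = diag(1, 0, 1) and P = [[0,1,0],[1,0,1],[0,1,0]]. Then every eigenvalue of the real 6×6 matrix 𝐙 = [[ −(1/2) D₁ , −ω P ], [ ω P , −(1/2) D₁ ]] has strictly negative real part. -/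
open Matrix Complex

/-- An eigenvalue equation for the damped chain `-D₁/2 + iωP` whose eigenvalue has nonnegative real
part has only the trivial solution: damping forces the end modes to vanish, and then the coupling
forces the middle mode to vanish. -/
lemma damped_chain_eq_zero {ω : ℝ} (hω : ω ≠ 0) {μ a b c : ℂ} (hμ : 0 ≤ μ.re)
    (ha : μ * a = -(1 / 2) * a + I * ω * b) (hb : μ * b = I * ω * (a + c))
    (hc : μ * c = -(1 / 2) * c + I * ω * b) : a = 0 ∧ b = 0 ∧ c = 0 := by
  have energy : μ.re * (normSq a + normSq b + normSq c) = -(1 / 2) * (normSq a + normSq c) := by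
    simp only [Complex.ext_iff, mul_re, mul_im, add_re, add_im, neg_re, neg_im, I_re, I_im,
      ofReal_re, ofReal_im, div_ofNat_re, div_ofNat_im, one_re, one_im] at ha hb hc
    simp only [normSq_apply]
    linear_combination a.re * ha.1 + a.im * ha.2 + b.re * hb.1 + b.im * hb.2 + c.re * hc.1 +
      c.im * hc.2
  have hnonneg : 0 ≤ μ.re * (normSq a + normSq b + normSq c) :=
    mul_nonneg hμ (by linarith [normSq_nonneg a, normSq_nonneg b, normSq_nonneg c])
  have ha0 : a = 0 := normSq_eq_zero.1 (by linarith [normSq_nonneg a, normSq_nonneg c])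
  have hc0 : c = 0 := normSq_eq_zero.1 (by linarith [normSq_nonneg a, normSq_nonneg c])
  refine ⟨ha0, ?_, hc0⟩
  simpa [ha0, hω] using ha

lemma Matrix.exists_mulVec_eq_smul_of_mem_spectrum {n K : Type*} [Fintype n] [DecidableEq n]
    [Field K] {A : Matrix n n K} {μ : K} (h : μ ∈ spectrum K A) :
    ∃ v ≠ 0, A *ᵥ v = μ • v := by
  rw [spectrum.mem_iff, Matrix.isUnit_iff_isUnit_det, isUnit_iff_ne_zero, not_not,
    ← Matrix.exists_mulVec_eq_zero_iff] at h
  obtain ⟨v, hv, h⟩ := h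
  refine ⟨v, hv, ?_⟩
  rw [Matrix.sub_mulVec, Algebra.algebraMap_eq_smul_one, Matrix.smul_mulVec, Matrix.one_mulVec,
    sub_eq_zero] at h
  exact h.symm

/-- The drift matrix of the three-mode boson chain model is stable for
every nonzero real `ω`: all its (complex) eigenvalues have strictly negative real part. -/
theorem stmt17 (ω : ℝ) (hω : ω ≠ 0)
    (D₁ P : Matrix (Fin 3) (Fin 3) ℝ)
    (hD₁ : D₁ = Matrix.diagonal ![1, 0, 1])
    (hP : P = !![0, 1, 0; 1, 0, 1; 0, 1, 0])
    (Z : Matrix (Fin 3 ⊕ Fin 3) (Fin 3 ⊕ Fin 3) ℝ)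
    (hZ : Z = Matrix.fromBlocks (-((1 : ℝ) / 2) • D₁) (-(ω • P)) (ω • P) (-((1 : ℝ) / 2) • D₁)) :
    ∀ μ ∈ spectrum ℂ (Z.map Complex.ofReal), μ.re < 0 := by
  intro μ hμ
  by_contra! hre
  obtain ⟨v, hv, h⟩ := Matrix.exists_mulVec_eq_smul_of_mem_spectrum hμ
  subst hD₁ hP hZ
  have hx (i : Fin 3) := congrFun h (Sum.inl i)
  have hy (i : Fin 3) := congrFun h (Sum.inr i)
  simp [Fin.forall_fin_succ, Matrix.mulVec, dotProduct, Fin.sum_univ_three,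
    Matrix.diagonal] at hx hy
  obtain ⟨hx0, hx1, hx2⟩ := hx
  obtain ⟨hy0, hy1, hy2⟩ := hy
  let x := fun i => v (Sum.inl i)
  let y := fun i => v (Sum.inr i)
  -- The combinations `x ± iy` decouple the two blocks.
  obtain ⟨p0, p1, p2⟩ := damped_chain_eq_zero hω (a := x 0 + I * y 0) (b := x 1 + I * y 1)
    (c := x 2 + I * y 2) hre
    (by linear_combination -hx0 - I * hy0 - ω * y 1 * I_sq)
    (by linear_combination -hx1 - I * hy1 - ω * (y 0 + y 2) * I_sq)
    (by linear_combination -hx2 - I * hy2 - ω * y 1 * I_sq)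
  obtain ⟨m0, m1, m2⟩ := damped_chain_eq_zero (neg_ne_zero.2 hω) (a := x 0 - I * y 0)
    (b := x 1 - I * y 1) (c := x 2 - I * y 2) hre
    (by push_cast; linear_combination -hx0 + I * hy0 - ω * y 1 * I_sq)
    (by push_cast; linear_combination -hx1 + I * hy1 - ω * (y 0 + y 2) * I_sq)
    (by push_cast; linear_combination -hx2 + I * hy2 - ω * y 1 * I_sq)
  have split {s t : ℂ} (hp : s + I * t = 0) (hm : s - I * t = 0) : s = 0 ∧ t = 0 :=
    ⟨by linear_combination (hp + hm) / 2,
      by linear_combination -I * (hp - hm) / 2 + t * I_sq⟩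
  apply hv
  ext (i | i) <;> fin_cases i
  exacts [(split p0 m0).1, (split p1 m1).1, (split p2 m2).1, (split p0 m0).2, (split p1 m1).2,
    (split p2 m2).2]
end

section
/- Let M₁, M₂ be complex d×d matrices satisfying M₁* M₁ − M₂ᵀ M̄₂ = I_d, M₂ᵀ M̄₁ = M₁* M₂, M₁ M₁* − M₂ M₂* = I_d and M₁ M₂ᵀ = M₂ M₁ᵀ, and let U, V be complex m×d matrices. Define Ũ := U M̄₁ + V̄ M₂ and Ṽ := Ū M₂ + V M̄₁, and the real-linear maps M z = M₁ z + M₂ z̄, M^♯ z = M₁* z + M₂ᵀ z̄ and C z = ( UᵀŪ + VᵀV̄ ) z + ( UᵀV + VᵀU ) z̄ on ℂ^d. Then for every z ∈ ℂ^d, M^♯( C( M z ) ) = ( ŨᵀŪ̃ + ṼᵀV̄̃ ) z + ( ŨᵀṼ + ṼᵀŨ ) z̄. -/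
open Matrix Complex

theorem Matrix.star_mulVec_eq_map_mulVec {m n R : Type*} [Fintype n] [CommSemiring R] [StarRing R]
    (A : Matrix m n R) (v : n → R) :
    star (A.mulVec v) = (A.map (starRingEnd R)).mulVec (star v) := by
  ext i
  simp [Matrix.mulVec, dotProduct, starRingEnd_apply]

theorem Matrix.map_starRingEnd_map_starRingEnd {m n R : Type*} [CommSemiring R] [StarRing R]
    (A : Matrix m n R) : (A.map (starRingEnd R)).map (starRingEnd R) = A := by
  ext i j
  simp

/-- For a symplectic transformation `M z = M₁ z + M₂ z̄`, the conjugated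
diffusion operator `M^♯ ∘ C ∘ M` is the diffusion operator with transformed Kraus parameter
matrices `Ũ = U M̄₁ + V̄ M₂` and `Ṽ = Ū M₂ + V M̄₁`. -/
theorem stmt18 (d m : ℕ) (M₁ M₂ : Matrix (Fin d) (Fin d) ℂ)
    (h1 : M₁ᴴ * M₁ - M₂ᵀ * M₂.map (starRingEnd ℂ) = 1)
    (h2 : M₂ᵀ * M₁.map (starRingEnd ℂ) = M₁ᴴ * M₂)
    (h3 : M₁ * M₁ᴴ - M₂ * M₂ᴴ = 1)
    (h4 : M₁ * M₂ᵀ = M₂ * M₁ᵀ)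
    (U V : Matrix (Fin m) (Fin d) ℂ)
    (Ut Vt : Matrix (Fin m) (Fin d) ℂ)
    (hUt : Ut = U * M₁.map (starRingEnd ℂ) + V.map (starRingEnd ℂ) * M₂)
    (hVt : Vt = U.map (starRingEnd ℂ) * M₂ + V * M₁.map (starRingEnd ℂ))
    (Mop Msharp Cop : (Fin d → ℂ) → (Fin d → ℂ))
    (hMop : ∀ z, Mop z = M₁.mulVec z + M₂.mulVec (star z))
    (hMsharp : ∀ z, Msharp z = M₁ᴴ.mulVec z + M₂ᵀ.mulVec (star z))
    (hCop : ∀ z, Cop z =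
      (Uᵀ * U.map (starRingEnd ℂ) + Vᵀ * V.map (starRingEnd ℂ)).mulVec z +
        (Uᵀ * V + Vᵀ * U).mulVec (star z)) :
    ∀ z : Fin d → ℂ,
      Msharp (Cop (Mop z)) =
        (Utᵀ * Ut.map (starRingEnd ℂ) + Vtᵀ * Vt.map (starRingEnd ℂ)).mulVec z +
          (Utᵀ * Vt + Vtᵀ * Ut).mulVec (star z) := by
  intro z
  have hM₁ : M₁ᴴ = (M₁.map (starRingEnd ℂ))ᵀ := rfl
  simp only [hMsharp, hCop, hMop, hUt, hVt, hM₁, Matrix.map_mul, Matrix.map_add _ (map_add _),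
    Matrix.transpose_add, Matrix.transpose_mul, Matrix.map_starRingEnd_map_starRingEnd,
    Matrix.add_mulVec, Matrix.mulVec_add, ← Matrix.mulVec_mulVec, star_add, star_star,
    Matrix.star_mulVec_eq_map_mulVec, Matrix.transpose_map]
  abel
end

section
/- Let M₁, M₂ be complex d×d matrices satisfying M₁* M₁ − M₂ᵀ M̄₂ = I_d, M₂ᵀ M̄₁ = M₁* M₂, M₁ M₁* − M₂ M₂* = I_d and M₁ M₂ᵀ = M₂ M₁ᵀ. Let U, V be complex m×d matrices, Ω a Hermitian and κ a symmetric d×d complex matrix. Define Ũ := U M̄₁ + V̄ M₂, Ṽ := Ū M₂ + V M̄₁, Ω̃ := M₁* Ω M₁ + M₂ᵀ Ωᵀ M̄₂ + M₁* κ M̄₂ + M₂ᵀ κ* M₁, κ̃ := M₁* Ω M₂ + M₂ᵀ Ωᵀ M̄₁ + M₁* κ M̄₁ + M₂ᵀ κ* M₂, and the real-linear maps M z = M₁ z + M₂ z̄, M⁻ z = M₁* z − M₂ᵀ z̄ and Z z = ( (UᵀŪ − VᵀV̄)/2 + iΩ ) z + ( (UᵀV − VᵀU)/2 + iκ ) z̄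 on ℂ^d. Then: (i) Ω̃ is Hermitian and κ̃ is symmetric; (ii) M⁻ is a two-sided inverse of M; (iii) for every z ∈ ℂ^d, M⁻( Z( M z ) ) = ( ( ŨᵀŪ̃ − ṼᵀV̄̃ )/2 + i Ω̃ ) z + ( ( ŨᵀṼ − ṼᵀŨ )/2 + i κ̃ ) z̄. -/
open Matrix Complex

theorem star_mulVec_eq_map_conj {m n : Type*} [Fintype n] (A : Matrix m n ℂ) (z : n → ℂ) :
    star (A.mulVec z) = (A.map (starRingEnd ℂ)).mulVec (star z) := by
  ext i
  simp [Matrix.mulVec, dotProduct]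

theorem realLinear_comp {l m n : Type*} [Fintype m] [Fintype n]
    (A₁ A₂ : Matrix l m ℂ) (B₁ B₂ : Matrix m n ℂ) (z : n → ℂ) :
    A₁.mulVec (B₁.mulVec z + B₂.mulVec (star z)) +
        A₂.mulVec (star (B₁.mulVec z + B₂.mulVec (star z))) =
      (A₁ * B₁ + A₂ * B₂.map (starRingEnd ℂ)).mulVec z +
        (A₁ * B₂ + A₂ * B₁.map (starRingEnd ℂ)).mulVec (star z) := by
  simp only [star_add, star_mulVec_eq_map_conj, star_star, Matrix.mulVec_add, Matrix.add_mulVec,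
    Matrix.mulVec_mulVec]
  abel

theorem map_conj_eq_transpose_conjTranspose {m n : Type*} (A : Matrix m n ℂ) :
    A.map (starRingEnd ℂ) = Aᴴᵀ := by
  ext i j
  simp

/-- For a symplectic transformation `M z = M₁ z + M₂ z̄`: (i) the
transformed Hamiltonian parameters `Ω̃` and `κ̃` are Hermitian resp. symmetric; (ii) the map
`M⁻ z = M₁* z − M₂ᵀ z̄` is a two-sided inverse of `M`; (iii) the conjugated drift operator
`M⁻¹ ∘ Z ∘ M` is the drift operator with transformed parameters `Ũ, Ṽ, Ω̃, κ̃`. -/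
theorem stmt19 (d m : ℕ) (M₁ M₂ : Matrix (Fin d) (Fin d) ℂ)
    (h1 : M₁ᴴ * M₁ - M₂ᵀ * M₂.map (starRingEnd ℂ) = 1)
    (h2 : M₂ᵀ * M₁.map (starRingEnd ℂ) = M₁ᴴ * M₂)
    (h3 : M₁ * M₁ᴴ - M₂ * M₂ᴴ = 1)
    (h4 : M₁ * M₂ᵀ = M₂ * M₁ᵀ)
    (U V : Matrix (Fin m) (Fin d) ℂ)
    (Ω κ : Matrix (Fin d) (Fin d) ℂ) (hΩ : Ω.IsHermitian) (hκ : κᵀ = κ)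
    (Ut Vt : Matrix (Fin m) (Fin d) ℂ) (Ωt κt : Matrix (Fin d) (Fin d) ℂ)
    (hUt : Ut = U * M₁.map (starRingEnd ℂ) + V.map (starRingEnd ℂ) * M₂)
    (hVt : Vt = U.map (starRingEnd ℂ) * M₂ + V * M₁.map (starRingEnd ℂ))
    (hΩt : Ωt = M₁ᴴ * Ω * M₁ + M₂ᵀ * Ωᵀ * M₂.map (starRingEnd ℂ) +
      M₁ᴴ * κ * M₂.map (starRingEnd ℂ) + M₂ᵀ * κᴴ * M₁)
    (hκt : κt = M₁ᴴ * Ω * M₂ + M₂ᵀ * Ωᵀ * M₁.map (starRingEnd ℂ) +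
      M₁ᴴ * κ * M₁.map (starRingEnd ℂ) + M₂ᵀ * κᴴ * M₂)
    (Mop Minv Zop : (Fin d → ℂ) → (Fin d → ℂ))
    (hMop : ∀ z, Mop z = M₁.mulVec z + M₂.mulVec (star z))
    (hMinv : ∀ z, Minv z = M₁ᴴ.mulVec z - M₂ᵀ.mulVec (star z))
    (hZop : ∀ z, Zop z =
      (((1 : ℂ) / 2) • (Uᵀ * U.map (starRingEnd ℂ) - Vᵀ * V.map (starRingEnd ℂ)) +
        Complex.I • Ω).mulVec z +
      (((1 : ℂ) / 2) • (Uᵀ * V - Vᵀ * U) + Complex.I • κ).mulVec (star z)) :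
    (Ωt.IsHermitian ∧ κtᵀ = κt) ∧
    (∀ z : Fin d → ℂ, Minv (Mop z) = z ∧ Mop (Minv z) = z) ∧
    (∀ z : Fin d → ℂ,
      Minv (Zop (Mop z)) =
        (((1 : ℂ) / 2) • (Utᵀ * Ut.map (starRingEnd ℂ) - Vtᵀ * Vt.map (starRingEnd ℂ)) +
          Complex.I • Ωt).mulVec z +
        (((1 : ℂ) / 2) • (Utᵀ * Vt - Vtᵀ * Ut) + Complex.I • κt).mulVec (star z)) := by
  have conj_transpose : ∀ {a b : ℕ} (A : Matrix (Fin a) (Fin b) ℂ), Aᵀᴴ = Aᴴᵀ := fun _ => rfl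
  have hMinv' : ∀ z, Minv z = M₁ᴴ.mulVec z + (-M₂ᵀ).mulVec (star z) := fun z => by
    rw [hMinv, Matrix.neg_mulVec, sub_eq_add_neg]
  have hκH : κᴴᵀ = κᴴ := by rw [← conj_transpose, hκ]
  refine ⟨⟨?_, ?_⟩, fun z => ⟨?_, ?_⟩, fun z => ?_⟩
  · rw [Matrix.IsHermitian, hΩt]
    simp only [map_conj_eq_transpose_conjTranspose, Matrix.conjTranspose_add,
      Matrix.conjTranspose_mul, Matrix.conjTranspose_conjTranspose, conj_transpose, hΩ.eq,
      Matrix.mul_assoc]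
    abel
  · rw [hκt]
    simp only [map_conj_eq_transpose_conjTranspose, Matrix.transpose_add,
      Matrix.transpose_mul, Matrix.transpose_transpose, hκ, hκH, Matrix.mul_assoc]
    abel
  · rw [hMinv', hMop, realLinear_comp, Matrix.neg_mul, Matrix.neg_mul, ← sub_eq_add_neg,
      ← sub_eq_add_neg, h1, h2, sub_self, Matrix.one_mulVec, Matrix.zero_mulVec, add_zero]
  · have e₁ : M₁ * M₁ᴴ + M₂ * (-M₂ᵀ).map (starRingEnd ℂ) = 1 := by
      rw [← h3, sub_eq_add_neg]
      simp [map_conj_eq_transpose_conjTranspose, conj_transpose]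
    have e₂ : M₁ * -M₂ᵀ + M₂ * M₁ᴴ.map (starRingEnd ℂ) = 0 := by
      simp [map_conj_eq_transpose_conjTranspose, h4]
    rw [hMinv', hMop, realLinear_comp, e₁, e₂, Matrix.one_mulVec, Matrix.zero_mulVec, add_zero]
  · rw [hMop, hZop, realLinear_comp, hMinv', realLinear_comp]
    congr 2
    all_goals
      rw [hUt, hVt]
      first | rw [hΩt] | rw [hκt]
      simp only [map_conj_eq_transpose_conjTranspose, Matrix.conjTranspose_add,
        Matrix.conjTranspose_sub, Matrix.conjTranspose_smul, Matrix.transpose_add,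
        Matrix.transpose_sub, Matrix.transpose_smul, Matrix.transpose_mul,
        Matrix.conjTranspose_mul, Matrix.conjTranspose_conjTranspose, conj_transpose, hΩ.eq, hκH,
        Matrix.transpose_transpose, Matrix.mul_assoc, Matrix.mul_add, Matrix.add_mul,
        Matrix.mul_sub, Matrix.sub_mul, Matrix.mul_smul, Matrix.smul_mul, Matrix.neg_mul,
        smul_add, smul_sub, star_def, Complex.conj_I, map_div₀, map_one, map_ofNat]
      module
end
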